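/- arXiv:1608.03873 — 12 statements merged into one kernel-verified Lean document; each statement's English description precedes it below -/
import Mathlib

section
/- Suppose x_1,…,x_N are the N pairwise distinct real zeros of p_N and λ_k are the Christoffel numbers. Then the following discrete orthogonality relation holds: for all integers m, n with 0 ≤ m, n ≤ N−1, ∑_{k=1}^N λ_k · p_m(x_k) · p_n(x_k) = ‖p_m‖² δ_{mn}. -/
open Polynomial MeasureTheory Finset

/-- The Lagrange interpolation basis polynomial `ℓ_j` with respect to the nodes `x`,
i.e. `ℓ_j(t) = ψ(t)/(ψ'(x_j)(t - x_j)) = ∏_{k ≠ j} (t - x_k)/(x_j - x_k)`. -/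
noncomputable def lag {N : ℕ} (x : Fin N → ℝ) (j : Fin N) : Polynomial ℝ :=
  ∏ k ∈ Finset.univ.erase j, Polynomial.C (x j - x k)⁻¹ * (Polynomial.X - Polynomial.C (x k))

theorem Polynomial.integrable_eval {ω : Measure ℝ}
    (hmom : ∀ n : ℕ, Integrable (fun t : ℝ => t ^ n) ω) (q : ℝ[X]) :
    Integrable (fun t => q.eval t) ω := by
  simp only [eval_eq_sum_range]
  exact integrable_finsetSum _ fun i _ => (hmom i).const_mul _

theorem integral_mul_eval_eq_zero_of_degree_lt {ω : Measure ℝ}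
    (hmom : ∀ n : ℕ, Integrable (fun t : ℝ => t ^ n) ω) {p : ℕ → ℝ[X]}
    (hdeg : ∀ ν : ℕ, (p ν).degree = ν) {N : ℕ}
    (horth : ∀ ν < N, ∫ t, (p N).eval t * (p ν).eval t ∂ω = 0)
    {q : ℝ[X]} (hq : q.degree < N) : ∫ t, (p N * q).eval t ∂ω = 0 := by
  suffices h : ∀ d ≤ N, ∀ q : ℝ[X], q.degree < d → ∫ t, (p N * q).eval t ∂ω = 0 from
    h N le_rfl q hq
  intro d
  induction d with
  | zero =>
    intro _ q hq
    have : q = 0 := by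
      ext i
      simpa using (degree_lt_iff_coeff_zero q 0).1 hq i (Nat.zero_le i)
    simp [this]
  | succ d ih =>
    intro hd q hq
    have hlead : (p d).coeff d ≠ 0 := coeff_ne_zero_of_eq_degree (hdeg d)
    set c := q.coeff d / (p d).coeff d with hc
    have hlow : (q - C c * p d).degree < d := by
      rw [degree_lt_iff_coeff_zero]
      intro i hi
      rcases hi.eq_or_lt with rfl | hi
      · simp [hc, hlead]
      · have h₁ : q.coeff i = 0 := (degree_lt_iff_coeff_zero q (d + 1)).1 hq i hi
        have h₂ : (p d).coeff i = 0 :=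
          coeff_eq_zero_of_degree_lt (by rw [hdeg]; exact_mod_cast hi)
        simp [h₁, h₂]
    have hsplit : ∀ t, (p N * q).eval t =
        (p N * (q - C c * p d)).eval t + c * ((p N).eval t * (p d).eval t) := by
      intro t
      simp only [eval_mul, eval_sub, eval_C]
      ring
    have hint : Integrable (fun t => c * ((p N).eval t * (p d).eval t)) ω := by
      simpa using (integrable_eval hmom (p N * p d)).const_mul c
    simp only [hsplit]
    rw [integral_add (integrable_eval hmom _) hint, integral_const_mul,
      ih (by omega) _ hlow, horth d (by omega)]
    simp

theorem lag_eq_basis {N : ℕ} (x : Fin N → ℝ) (j : Fin N) :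
    lag x j = Lagrange.basis Finset.univ x j := rfl

theorem integral_eval_eq_sum_of_degree_lt {ω : Measure ℝ}
    (hmom : ∀ n : ℕ, Integrable (fun t : ℝ => t ^ n) ω) {N : ℕ}
    {x : Fin N → ℝ} (hx : Function.Injective x) {r : ℝ[X]} (hr : r.degree < N) :
    ∫ t, r.eval t ∂ω = ∑ k, (∫ t, (lag x k).eval t ∂ω) * r.eval (x k) := by
  have hr' : r = ∑ k, C (r.eval (x k)) * lag x k := by
    simpa [lag_eq_basis, Lagrange.interpolate_apply] using
      Lagrange.eq_interpolate (s := Finset.univ) (v := x) hx.injOn (by simpa using hr)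
  have heval : ∀ t, r.eval t = ∑ k, r.eval (x k) * (lag x k).eval t := by
    intro t
    conv_lhs => rw [hr']
    simp [eval_finsetSum]
  rw [integral_congr_ae (Filter.Eventually.of_forall heval), integral_finsetSum _
    fun k _ => (integrable_eval hmom (lag x k)).const_mul _]
  exact Finset.sum_congr rfl fun k _ => by rw [integral_const_mul, mul_comm]

theorem stmt3
    (ω : Measure ℝ)
    (hmom : ∀ n : ℕ, Integrable (fun t : ℝ => t ^ n) ω)
    (hsupp : {t : ℝ | ∀ U ∈ nhds t, 0 < ω U}.Infinite)
    (p : ℕ → Polynomial ℝ)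
    (hdeg : ∀ ν : ℕ, (p ν).degree = ν)
    (horth : ∀ μ' ν : ℕ, μ' ≠ ν → ∫ t, (p μ').eval t * (p ν).eval t ∂ω = 0)
    (hnorm : ∀ ν : ℕ, 0 < ∫ t, ((p ν).eval t) ^ 2 ∂ω)
    (N : ℕ) (hN : 0 < N)
    (x : Fin N → ℝ) (hx : Function.Injective x)
    (hzero : ∀ j : Fin N, (p N).eval (x j) = 0)
    (lam : Fin N → ℝ)
    (hlam : ∀ j : Fin N, lam j = ∫ t, (lag x j).eval t ∂ω) :
    ∀ m n : Fin N,
      ∑ k : Fin N, lam k * (p m).eval (x k) * (p n).eval (x k) =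
      (∫ t, ((p m).eval t) ^ 2 ∂ω) * (if m = n then 1 else 0) := by
  intro m n
  have hm : (m : ℕ) < N := m.2
  have hn : (n : ℕ) < N := n.2
  have hp : p N ≠ 0 := fun h => by simpa [h] using hdeg N
  set f := p m * p n with hf
  have hdiv : p N * (f / p N) + f % p N = f := EuclideanDomain.div_add_mod f (p N)
  have hrem : (f % p N).degree < N := hdeg N ▸ degree_mod_lt f hp
  have hquot : (f / p N).degree < N := by
    have hnat : ∀ ν, (p ν).natDegree = ν := fun ν => natDegree_eq_of_degree_eq_some (hdeg ν)
    have hle : (f / p N).natDegree < N := by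
      by_cases hzq : f / p N = 0
      · simpa [hzq] using hN
      have hfd : f.natDegree ≤ m + n := by
        simpa [hnat] using natDegree_mul_le (p := p m) (q := p n)
      have hrd : (f % p N).natDegree ≤ N := natDegree_le_of_degree_le hrem.le
      have hmul : N + (f / p N).natDegree = (f - f % p N).natDegree := by
        rw [← eq_sub_of_add_eq hdiv, natDegree_mul hp hzq, hnat]
      have := natDegree_sub_le f (f % p N)
      omega
    exact degree_le_natDegree.trans_lt (by exact_mod_cast hle)
  have hnode : ∀ k, (f % p N).eval (x k) = (p m).eval (x k) * (p n).eval (x k) := by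
    intro k
    simpa [hzero, hf] using congrArg (eval (x k)) hdiv
  have hquad : ∑ k, lam k * (p m).eval (x k) * (p n).eval (x k) =
      ∫ t, (p m).eval t * (p n).eval t ∂ω := by
    calc ∑ k, lam k * (p m).eval (x k) * (p n).eval (x k)
        = ∫ t, (f % p N).eval t ∂ω := by
          rw [integral_eval_eq_sum_of_degree_lt hmom hx hrem]
          exact Finset.sum_congr rfl fun k _ => by rw [hlam, hnode, mul_assoc]
      _ = ∫ t, ((p N * (f / p N)).eval t + (f % p N).eval t) ∂ω := by
          rw [integral_add (integrable_eval hmom _) (integrable_eval hmom _),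
            integral_mul_eval_eq_zero_of_degree_lt hmom hdeg
              (fun ν hν => horth N ν hν.ne') hquot, zero_add]
      _ = ∫ t, (p m).eval t * (p n).eval t ∂ω := by
          simp only [← eval_add, hdiv]
          simp only [hf, eval_mul]
  rw [hquad]
  split_ifs with h
  · simp [h, sq]
  · rw [horth m n (fun h' => h (Fin.ext h')), mul_zero]
end

section
/- Suppose 𝒟 is a linear operator on real polynomials with 𝒟(ℙ^ν) ⊆ ℙ^ν for every ν and 𝒟p_ν = μ_ν p_ν for every ν (μ_ν ∈ ℝ). Let x_1,…,x_N be the N pairwise distinct real zeros of p_N and let D^c be the N×N matrix with entries D^c_{nk} = (𝒟ℓ_k)(x_n). Then for all integers m, n with 0 ≤ m ≤ N−1 and 1 ≤ n ≤ N, ∑_{k=1}^N D^c_{nk} p_m(x_k) = μ_m p_m(x_n); that is, for each m = 0,1,…,N−1 the vector v^(m) with components v^(m)_n = p_m(x_n) is an eigenvector of D^c with eigenvalue μ_m. In particular, taking m = 0, every row sum of D^c equals μ_0: ∑_{k=1}^N D^c_{nk} = μ_0 for every n. -/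
open Polynomial MeasureTheory Finset

/-- A polynomial of degree less than the number of nodes is the combination of the Lagrange
polynomials with its nodal values as coefficients. -/
lemma sum_eval_smul_lag {N : ℕ} {x : Fin N → ℝ} (hx : Function.Injective x) {q : Polynomial ℝ}
    (hq : q.degree < N) : ∑ k, q.eval (x k) • lag x k = q := by
  conv_rhs => rw [Lagrange.eq_interpolate (f := q) (s := Finset.univ) (v := x) hx.injOn (by simpa using hq),
    Lagrange.interpolate_apply]
  exact Finset.sum_congr rfl fun k _ => Polynomial.smul_eq_C_mul _

/-- The collocation matrix of a linear map acts exactly on nodal values of polynomials of degree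
less than the number of nodes. -/
lemma sum_eval_map_lag_mul {N : ℕ} {x : Fin N → ℝ} (hx : Function.Injective x)
    (D : Polynomial ℝ →ₗ[ℝ] Polynomial ℝ) {q : Polynomial ℝ} (hq : q.degree < N) (t : ℝ) :
    ∑ k, (D (lag x k)).eval t * q.eval (x k) = (D q).eval t := by
  conv_rhs => rw [← sum_eval_smul_lag hx hq]
  simp [Polynomial.eval_finsetSum, mul_comm]

theorem stmt4
    (ω : Measure ℝ)
    (hmom : ∀ n : ℕ, Integrable (fun t : ℝ => t ^ n) ω)
    (hsupp : {t : ℝ | ∀ U ∈ nhds t, 0 < ω U}.Infinite)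
    (p : ℕ → Polynomial ℝ)
    (hdeg : ∀ ν : ℕ, (p ν).degree = ν)
    (horth : ∀ μ' ν : ℕ, μ' ≠ ν → ∫ t, (p μ').eval t * (p ν).eval t ∂ω = 0)
    (hnorm : ∀ ν : ℕ, 0 < ∫ t, ((p ν).eval t) ^ 2 ∂ω)
    (D : Polynomial ℝ →ₗ[ℝ] Polynomial ℝ)
    (hD : ∀ (ν : ℕ) (q : Polynomial ℝ), q.degree ≤ (ν : WithBot ℕ) →
      (D q).degree ≤ (ν : WithBot ℕ))
    (μ : ℕ → ℝ)
    (hDp : ∀ ν : ℕ, D (p ν) = μ ν • p ν)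
    (N : ℕ) (hN : 0 < N)
    (x : Fin N → ℝ) (hx : Function.Injective x)
    (hzero : ∀ j : Fin N, (p N).eval (x j) = 0)
    (Dc : Matrix (Fin N) (Fin N) ℝ)
    (hDc : ∀ n k : Fin N, Dc n k = (D (lag x k)).eval (x n)) :
    (∀ (m : Fin N) (n : Fin N),
      ∑ k : Fin N, Dc n k * (p m).eval (x k) = μ m * (p m).eval (x n)) ∧
    (∀ n : Fin N, ∑ k : Fin N, Dc n k = μ 0) := by
  have hvec (m n : Fin N) :
      ∑ k : Fin N, Dc n k * (p m).eval (x k) = μ m * (p m).eval (x n) := by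
    simp_rw [hDc]
    rw [sum_eval_map_lag_mul hx D (by rw [hdeg]; exact_mod_cast m.2), hDp,
      Polynomial.eval_smul, smul_eq_mul]
  refine ⟨hvec, fun n => ?_⟩
  have h0 := hvec ⟨0, hN⟩ n
  have hconst : p 0 = Polynomial.C ((p 0).coeff 0) :=
    Polynomial.eq_C_of_degree_le_zero (hdeg 0).le
  have hne : (p 0).coeff 0 ≠ 0 := Polynomial.coeff_ne_zero_of_eq_degree (hdeg 0)
  rw [hconst] at h0
  simp only [Polynomial.eval_C, ← Finset.sum_mul] at h0
  exact mul_right_cancel₀ hne h0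
end

section
/- Suppose 𝒟p_ν = μ_ν p_ν for every ν (μ_ν ∈ ℝ) and let x_1,…,x_N be the N pairwise distinct real zeros of p_N. Then for every pair of integers m, n with 0 ≤ m ≤ N−1 and 1 ≤ n ≤ N such that a_4(x_n) ≠ 0: ∑_{k=1, k≠n}^N (A_{nk})² · (p_m(x_k)/p_N'(x_k)) · {4a_4(x_n)p_N'''(x_n) + 3[a_3(x_n) − 4a_4(x_n)A_{nk}]p_N''(x_n) − 2[3A_{nk}(a_3(x_n) − 4a_4(x_n)A_{nk}) − a_2(x_n)]p_N'(x_n)} = ( −μ_m − (1/(4a_4(x_n)p_N'(x_n)))·{a_3(x_n) − (4/5)[a_4'(x_n) + a_3(x_n)]}·[a_3(x_n)p_N'''(x_n) + a_2(x_n)p_N''(x_n) + a_1(x_n)p_N'(x_n)] + (p_N'''(x_n)/(3p_N'(x_n)))·{a_2(x_n) − (3/5)[a_3'(x_n) + a_2(x_n)]} + (p_N''(x_n)/(2p_N'(x_n)))·{a_1(x_n) − (2/5)[a_2'(x_n) + a_1(x_n)]} − (1/5)[a_1'(x_n) − μ_N] ) · p_m(x_n). -/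
open Polynomial MeasureTheory Finset

/-- `dvl q k t` is the `k`-th derivative of the polynomial `q`, evaluated at `t`. -/
noncomputable def dvl (q : Polynomial ℝ) (k : ℕ) (t : ℝ) : ℝ :=
  (Polynomial.derivative^[k] q).eval t

/-- Leibniz rule for the higher derivatives of `(X - c) * q`, evaluated at a point. -/
theorem dvl_X_sub_C_mul_succ (q : Polynomial ℝ) (c t : ℝ) (j : ℕ) :
    dvl ((X - C c) * q) (j + 1) t = (t - c) * dvl q (j + 1) t + (j + 1) * dvl q j t := by
  have key : derivative^[j + 1] ((X - C c) * q) =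
      (X - C c) * derivative^[j + 1] q + C ((j : ℝ) + 1) * derivative^[j] q := by
    induction j with
    | zero => simp [derivative_mul]; ring
    | succ j ih =>
      rw [Function.iterate_succ_apply', ih]
      simp only [derivative_add, derivative_mul, derivative_sub, derivative_X, derivative_C,
        ← Function.iterate_succ_apply' derivative]
      simp only [Nat.succ_eq_add_one, Nat.cast_add, Nat.cast_one, C_add, C_1]
      ring
  simp [dvl, key]

theorem degree_lt_degree_X_sub_C_mul {q : Polynomial ℝ} (hq : q ≠ 0) (c : ℝ) :
    q.degree < ((X - C c) * q).degree := by
  rw [degree_mul, degree_X_sub_C, degree_eq_natDegree hq]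
  norm_cast
  omega

/-- If `P` of degree `N` vanishes at the `N` distinct points `x j`, its linear cofactor at `x k`
does not vanish at `x k`. -/
theorem eval_cofactor_ne_zero {N : ℕ} {P q : Polynomial ℝ} (hP : P.degree = N)
    {x : Fin N → ℝ} (hx : Function.Injective x) (hzero : ∀ j, P.eval (x j) = 0)
    {k : Fin N} (hq : P = (X - C (x k)) * q) : q.eval (x k) ≠ 0 := by
  intro h
  have hP0 : P ≠ 0 := by rintro rfl; simp at hP
  have hq0 : q ≠ 0 := by rintro rfl; simp at hq; exact hP0 hq
  have hdeg : q.degree < N := by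
    rw [← hP, hq]
    exact degree_lt_degree_X_sub_C_mul hq0 _
  refine hq0 (eq_zero_of_degree_lt_of_eval_index_eq_zero (s := Finset.univ) hx.injOn
    (by simpa using hdeg) fun j _ => ?_)
  rcases eq_or_ne j k with rfl | hjk
  · exact h
  · have := hzero j
    rw [hq, eval_mul, eval_sub, eval_X, eval_C] at this
    exact (mul_eq_zero.1 this).resolve_left (sub_ne_zero.2 (hx.ne hjk))

/-- Lagrange interpolation at the zeros of `P`, written through the linear cofactors of `P`. -/
theorem sum_cofactor_eq {N : ℕ} {P r : Polynomial ℝ} (hP : P.degree = N) (hr : r.degree < N)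
    {x : Fin N → ℝ} (hx : Function.Injective x) (hzero : ∀ j, P.eval (x j) = 0)
    {q : Fin N → Polynomial ℝ} (hq : ∀ k, P = (X - C (x k)) * q k) :
    ∑ k, C (r.eval (x k) / (q k).eval (x k)) * q k = r := by
  have hP0 : P ≠ 0 := by rintro rfl; simp at hP
  have hdeg : ∀ k, (q k).degree < N := fun k => by
    have hq0 : q k ≠ 0 := fun h => hP0 (by rw [hq k, h, mul_zero])
    rw [← hP, hq k]
    exact degree_lt_degree_X_sub_C_mul hq0 _
  refine eq_of_degrees_lt_of_eval_index_eq (s := Finset.univ) hx.injOn ?_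
    (by simpa using hr) fun j _ => ?_
  · rw [← mem_degreeLT]
    refine Submodule.sum_mem _ fun k _ => ?_
    rw [← smul_eq_C_mul]
    exact Submodule.smul_mem _ _ (mem_degreeLT.2 (by simpa using hdeg k))
  · rw [eval_finsetSum, Finset.sum_eq_single j]
    · rw [eval_mul, eval_C, div_mul_cancel₀ _ (eval_cofactor_ne_zero hP hx hzero (hq j))]
    · intro k _ hkj
      have := hzero j
      rw [hq k, eval_mul, eval_sub, eval_X, eval_C] at this
      rw [eval_mul, (mul_eq_zero.1 this).resolve_left (sub_ne_zero.2 (hx.ne hkj.symm)), mul_zero]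
    · simp

/-- The operator `∑ aⱼ dʲ/dxʲ` (`1 ≤ j ≤ 4`) applied to `q` and evaluated at `t`. -/
noncomputable def diffOpEval (a₁ a₂ a₃ a₄ : Polynomial ℝ) (t : ℝ) (q : Polynomial ℝ) : ℝ :=
  a₄.eval t * dvl q 4 t + a₃.eval t * dvl q 3 t + a₂.eval t * dvl q 2 t + a₁.eval t * dvl q 1 t

theorem dvl_sum_C_mul {ι : Type*} (s : Finset ι) (c : ι → ℝ) (q : ι → Polynomial ℝ) (j : ℕ)
    (t : ℝ) : dvl (∑ k ∈ s, C (c k) * q k) j t = ∑ k ∈ s, c k * dvl (q k) j t := by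
  simp [dvl, iterate_derivative_sum, iterate_derivative_C_mul, eval_finsetSum]

theorem diffOpEval_sum_C_mul {ι : Type*} (a₁ a₂ a₃ a₄ : Polynomial ℝ) (t : ℝ) (s : Finset ι)
    (c : ι → ℝ) (q : ι → Polynomial ℝ) :
    diffOpEval a₁ a₂ a₃ a₄ t (∑ k ∈ s, C (c k) * q k) =
      ∑ k ∈ s, c k * diffOpEval a₁ a₂ a₃ a₄ t (q k) := by
  simp only [diffOpEval, dvl_sum_C_mul, Finset.mul_sum, ← Finset.sum_add_distrib]
  exact Finset.sum_congr rfl fun k _ => by ring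

/-- Derivatives of an eigenpolynomial at one of its zeros are constrained by the eigenvalue
equation and its derivative. -/
theorem eigen_dvl_relation {a₁ a₂ a₃ a₄ P : Polynomial ℝ} {l : ℝ}
    (h : a₄ * derivative^[4] P + a₃ * derivative^[3] P + a₂ * derivative^[2] P +
      a₁ * derivative P = C l * P) (t : ℝ) :
    a₄.eval t * dvl P 5 t + (dvl a₄ 1 t + a₃.eval t) * dvl P 4 t +
      (dvl a₃ 1 t + a₂.eval t) * dvl P 3 t + (dvl a₂ 1 t + a₁.eval t) * dvl P 2 t +
      dvl a₁ 1 t * dvl P 1 t = l * dvl P 1 t := by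
  have := congrArg (fun r => (derivative r).eval t) h
  simp only [derivative_add, derivative_mul, derivative_C, eval_add, eval_mul, eval_C,
    Function.iterate_succ_apply', Function.iterate_zero, id_eq, zero_mul, zero_add] at this
  simp only [dvl, Function.iterate_succ_apply', Function.iterate_zero, id_eq]
  linear_combination this

theorem stmt6
    (ω : Measure ℝ)
    (hmom : ∀ n : ℕ, Integrable (fun t : ℝ => t ^ n) ω)
    (hsupp : {t : ℝ | ∀ U ∈ nhds t, 0 < ω U}.Infinite)
    (p : ℕ → Polynomial ℝ)
    (hdeg : ∀ ν : ℕ, (p ν).degree = ν)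
    (horth : ∀ μ' ν : ℕ, μ' ≠ ν → ∫ t, (p μ').eval t * (p ν).eval t ∂ω = 0)
    (hnorm : ∀ ν : ℕ, 0 < ∫ t, ((p ν).eval t) ^ 2 ∂ω)
    (a₁ a₂ a₃ a₄ : Polynomial ℝ)
    (ha₁ : a₁.degree ≤ (1 : WithBot ℕ)) (ha₂ : a₂.degree ≤ (2 : WithBot ℕ))
    (ha₃ : a₃.degree ≤ (3 : WithBot ℕ)) (ha₄ : a₄.degree ≤ (4 : WithBot ℕ))
    (μ : ℕ → ℝ)
    (hD : ∀ ν : ℕ,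
      a₄ * Polynomial.derivative^[4] (p ν) + a₃ * Polynomial.derivative^[3] (p ν) +
        a₂ * Polynomial.derivative^[2] (p ν) + a₁ * Polynomial.derivative (p ν) =
      Polynomial.C (μ ν) * p ν)
    (N : ℕ) (hN : 0 < N)
    (x : Fin N → ℝ) (hx : Function.Injective x)
    (hzero : ∀ j : Fin N, (p N).eval (x j) = 0) :
    ∀ (m n : Fin N), a₄.eval (x n) ≠ 0 →
      ∑ k ∈ Finset.univ.erase n,
        ((x n - x k)⁻¹) ^ 2 * ((p m).eval (x k) / dvl (p N) 1 (x k)) *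
          (4 * a₄.eval (x n) * dvl (p N) 3 (x n)
            + 3 * (a₃.eval (x n) - 4 * a₄.eval (x n) * (x n - x k)⁻¹) * dvl (p N) 2 (x n)
            - 2 * (3 * (x n - x k)⁻¹ *
                (a₃.eval (x n) - 4 * a₄.eval (x n) * (x n - x k)⁻¹) - a₂.eval (x n)) *
                dvl (p N) 1 (x n))
      =
      (- μ m
        - (1 / (4 * a₄.eval (x n) * dvl (p N) 1 (x n))) *
            (a₃.eval (x n) - (4 / 5) * (dvl a₄ 1 (x n) + a₃.eval (x n))) *
            (a₃.eval (x n) * dvl (p N) 3 (x n) + a₂.eval (x n) * dvl (p N) 2 (x n)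
              + a₁.eval (x n) * dvl (p N) 1 (x n))
        + (dvl (p N) 3 (x n) / (3 * dvl (p N) 1 (x n))) *
            (a₂.eval (x n) - (3 / 5) * (dvl a₃ 1 (x n) + a₂.eval (x n)))
        + (dvl (p N) 2 (x n) / (2 * dvl (p N) 1 (x n))) *
            (a₁.eval (x n) - (2 / 5) * (dvl a₂ 1 (x n) + a₁.eval (x n)))
        - (1 / 5) * (dvl a₁ 1 (x n) - μ N)) * (p m).eval (x n) := by
  intro m n ha
  choose q hq using fun k => dvd_iff_isRoot.2 (hzero k)
  have hval : ∀ k, (q k).eval (x k) = dvl (p N) 1 (x k) := fun k => by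
    have := dvl_X_sub_C_mul_succ (q k) (x k) (x k) 0
    rw [← hq k] at this
    simpa [dvl] using this.symm
  have hd : dvl (p N) 1 (x n) ≠ 0 :=
    hval n ▸ eval_cofactor_ne_zero (hdeg N) hx hzero (hq n)
  have hDt : ∀ ν t, diffOpEval a₁ a₂ a₃ a₄ t (p ν) = μ ν * (p ν).eval t := fun ν t => by
    simpa [diffOpEval, dvl] using congrArg (eval t) (hD ν)
  have hinterp := sum_cofactor_eq (r := p m) (hdeg N)
    (by rw [hdeg]; exact_mod_cast m.2) hx hzero hq
  have hsum := diffOpEval_sum_C_mul a₁ a₂ a₃ a₄ (x n) Finset.univ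
    (fun k => (p m).eval (x k) / (q k).eval (x k)) q
  rw [hinterp, hDt, ← Finset.add_sum_erase _ _ (Finset.mem_univ n)] at hsum
  have hoff : ∀ k ∈ Finset.univ.erase n,
      ((x n - x k)⁻¹) ^ 2 * ((p m).eval (x k) / dvl (p N) 1 (x k)) *
        (4 * a₄.eval (x n) * dvl (p N) 3 (x n)
          + 3 * (a₃.eval (x n) - 4 * a₄.eval (x n) * (x n - x k)⁻¹) * dvl (p N) 2 (x n)
          - 2 * (3 * (x n - x k)⁻¹ *
              (a₃.eval (x n) - 4 * a₄.eval (x n) * (x n - x k)⁻¹) - a₂.eval (x n)) *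
              dvl (p N) 1 (x n)) =
      -((p m).eval (x k) / (q k).eval (x k) * diffOpEval a₁ a₂ a₃ a₄ (x n) (q k)) := by
    intro k hk
    have hxk : x n - x k ≠ 0 := sub_ne_zero.2 (hx.ne (Finset.ne_of_mem_erase hk).symm)
    have hq0 : dvl (q k) 0 (x n) = 0 := by
      have := hzero n
      rw [hq k, eval_mul, eval_sub, eval_X, eval_C] at this
      exact (mul_eq_zero.1 this).resolve_left hxk
    have h1 := dvl_X_sub_C_mul_succ (q k) (x k) (x n) 0
    have h2 := dvl_X_sub_C_mul_succ (q k) (x k) (x n) 1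
    have h3 := dvl_X_sub_C_mul_succ (q k) (x k) (x n) 2
    have h4 := dvl_X_sub_C_mul_succ (q k) (x k) (x n) 3
    have h0 := hDt N (x n)
    rw [← hq k] at h1 h2 h3 h4
    rw [hzero n, diffOpEval] at h0
    norm_num at h0 h1 h2 h3 h4
    rw [hq0, add_zero] at h1
    rw [hval k]
    generalize (p m).eval (x k) / dvl (p N) 1 (x k) = c
    rw [diffOpEval]
    rw [h1, h2, h3, h4] at h0
    rw [h1, h2, h3]
    field_simp
    linear_combination (c * (x n - x k) ^ 2) * h0
  rw [Finset.sum_congr rfl hoff, Finset.sum_neg_distrib]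
  have hdiag : ∀ j : ℕ, dvl (p N) (j + 1) (x n) = (j + 1) * dvl (q n) j (x n) := fun j => by
    have := dvl_X_sub_C_mul_succ (q n) (x n) (x n) j
    rwa [← hq n, sub_self, zero_mul, zero_add] at this
  have h0 := hDt N (x n)
  rw [hzero n, mul_zero, diffOpEval] at h0
  have h5 := eigen_dvl_relation (hD N) (x n)
  have e1 : dvl (q n) 1 (x n) = dvl (p N) 2 (x n) / 2 := by
    rw [hdiag 1]; push_cast; ring
  have e2 : dvl (q n) 2 (x n) = dvl (p N) 3 (x n) / 3 := by
    rw [hdiag 2]; push_cast; ring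
  have e3 : dvl (q n) 3 (x n) = dvl (p N) 4 (x n) / 4 := by
    rw [hdiag 3]; push_cast; ring
  have e4 : dvl (q n) 4 (x n) = dvl (p N) 5 (x n) / 5 := by
    rw [hdiag 4]; push_cast; ring
  have h4 : dvl (p N) 4 (x n) = -(a₃.eval (x n) * dvl (p N) 3 (x n) +
      a₂.eval (x n) * dvl (p N) 2 (x n) + a₁.eval (x n) * dvl (p N) 1 (x n)) / a₄.eval (x n) := by
    rw [eq_div_iff ha]
    linear_combination h0
  have hdiagOp : diffOpEval a₁ a₂ a₃ a₄ (x n) (q n) =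
      (1 / 4) * (a₃.eval (x n) - (4 / 5) * (dvl a₄ 1 (x n) + a₃.eval (x n))) * dvl (p N) 4 (x n)
      + (1 / 3) * (a₂.eval (x n) - (3 / 5) * (dvl a₃ 1 (x n) + a₂.eval (x n))) * dvl (p N) 3 (x n)
      + (1 / 2) * (a₁.eval (x n) - (2 / 5) * (dvl a₂ 1 (x n) + a₁.eval (x n))) * dvl (p N) 2 (x n)
      - (1 / 5) * (dvl a₁ 1 (x n) - μ N) * dvl (p N) 1 (x n) := by
    rw [diffOpEval, e1, e2, e3, e4]
    linear_combination (1 / 5) * h5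
  rw [hdiagOp, h4, hval n] at hsum
  have hgoal := eq_sub_of_add_eq' hsum.symm
  rw [hgoal]
  field_simp
  ring
end

section
/- Let N ≥ 1 and let x_1,…,x_N be pairwise distinct real numbers with P_N(x_n) = 0 and −1 < x_n < 1 for every n (i.e., the zeros of the Krall-Legendre polynomial P_N). Then for all n = 1,…,N and m = 0,1,…,N−1: ∑_{k=1, k≠n}^N (A_{nk})² · (P_m(x_k)/P_N'(x_k)) · {4(1−x_n²)² P_N'''(x_n) − 12(x_n²−1)[A_{nk}(x_n²−1) − 2x_n] P_N''(x_n) + 8(x_n²−1)[3A_{nk}²(x_n²−1) − 6A_{nk}x_n + α + 3] P_N'(x_n)} = { −m(m+1)(m²+m+4α−2) + (8α(x_n²−1)/15)·(P_N'''(x_n)/P_N'(x_n)) + (12αx_n/5)·(P_N''(x_n)/P_N'(x_n)) + [8α(x_n²+1) + N(N+1)(N²+N+4α−2)(x_n²−1)]/(5(x_n²−1)) } · P_m(x_n). -/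
open Polynomial Finset

/-- The Krall-Legendre polynomial of degree `ν` with parameter `α`:
`P_ν(x) = ∑_{k=0}^{⌊ν/2⌋} (−1)^k (2ν−2k)! [α + ν(ν−1)/2 + 2k] / (2^ν k! (ν−k)! (ν−2k)!) x^{ν−2k}`. -/
noncomputable def krallLegendre (α : ℝ) (ν : ℕ) : Polynomial ℝ :=
  ∑ k ∈ Finset.range (ν / 2 + 1),
    Polynomial.C ((-1 : ℝ) ^ k * ((2 * ν - 2 * k).factorial : ℝ) *
        (α + (ν : ℝ) * ((ν : ℝ) - 1) / 2 + 2 * (k : ℝ)) /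
      ((2 : ℝ) ^ ν * (k.factorial : ℝ) * ((ν - k).factorial : ℝ) *
        ((ν - 2 * k).factorial : ℝ))) *
    Polynomial.X ^ (ν - 2 * k)

/-- The fourth-order operator having the Krall-Legendre polynomials as eigenfunctions. -/
noncomputable def krallOperator (α : ℝ) (p : ℝ[X]) : ℝ[X] :=
  (1 - X ^ 2) ^ 2 * derivative^[4] p + C 8 * X * (X ^ 2 - 1) * derivative^[3] p
    + C (4 * (3 + α)) * (X ^ 2 - 1) * derivative^[2] p + C (8 * α) * X * derivative p

/-- The eigenvalue of `krallOperator α` belonging to degree `t`. -/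
noncomputable def krallEigenvalue (α t : ℝ) : ℝ :=
  t * (t + 1) * (t ^ 2 + t + 4 * α - 2)

lemma coeff_krallOperator (α : ℝ) (p : ℝ[X]) (i : ℕ) :
    (krallOperator α p).coeff i = krallEigenvalue α i * p.coeff i
      - ((i : ℝ) + 1) * (i + 2) * (2 * (i + 1) * (i + 2) + 8 + 4 * α) * p.coeff (i + 2)
      + ((i : ℝ) + 1) * (i + 2) * (i + 3) * (i + 4) * p.coeff (i + 4) := by
  have expand : krallOperator α p =
      derivative^[4] p - C 2 * (X ^ 2 * derivative^[4] p) + X ^ 4 * derivative^[4] p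
        + C 8 * (X ^ 3 * derivative^[3] p) - C 8 * (X ^ 1 * derivative^[3] p)
        + C (4 * (3 + α)) * (X ^ 2 * derivative^[2] p) - C (4 * (3 + α)) * derivative^[2] p
        + C (8 * α) * (X ^ 1 * derivative p) := by
    rw [krallOperator, show (C 2 : ℝ[X]) = 2 from rfl]
    ring
  rw [expand]
  simp only [coeff_add, coeff_sub, coeff_C_mul, coeff_X_pow_mul', Function.iterate_succ,
    Function.iterate_zero, Function.comp_apply, id_eq, coeff_derivative, krallEigenvalue]
  rcases i with _ | _ | _ | _ | i
  · norm_num; ring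
  · norm_num; ring
  · norm_num; ring
  · norm_num; ring
  · simp only [show i + 1 + 1 + 1 + 1 - 2 = i + 2 by omega,
      show i + 1 + 1 + 1 + 1 - 4 = i by omega, show i + 1 + 1 + 1 + 1 - 3 = i + 1 by omega,
      show i + 1 + 1 + 1 + 1 - 1 = i + 3 by omega, show 2 ≤ i + 1 + 1 + 1 + 1 by omega,
      show 4 ≤ i + 1 + 1 + 1 + 1 by omega, show 3 ≤ i + 1 + 1 + 1 + 1 by omega,
      show 1 ≤ i + 1 + 1 + 1 + 1 by omega, if_true, add_assoc, Nat.reduceAdd]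
    push_cast
    ring

/-- The part of the coefficient of `X ^ i` in `krallLegendre α (i + 2 * k)` not depending
on `α`. -/
noncomputable def krallWeight (k i : ℕ) : ℝ :=
  (-1 : ℝ) ^ k * ((2 * i + 2 * k).factorial : ℝ) /
    ((2 : ℝ) ^ (i + 2 * k) * (k.factorial : ℝ) * ((i + k).factorial : ℝ) * (i.factorial : ℝ))

lemma krallWeight_step (k i : ℕ) :
    ((i : ℝ) + 1) * (i + 2) * krallWeight k (i + 2)
      = -(2 * (k + 1) * (2 * i + 2 * k + 3)) * krallWeight (k + 1) i := by
  unfold krallWeight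
  rw [show 2 * (i + 2) + 2 * k = (2 * i + 2 * k + 2) + 1 + 1 by ring,
    show 2 * i + 2 * (k + 1) = 2 * i + 2 * k + 2 by ring,
    show i + 2 + 2 * k = i + 2 * (k + 1) by ring,
    show i + 2 + k = (i + k + 1) + 1 by ring, show i + (k + 1) = i + k + 1 by ring,
    Nat.factorial_succ (2 * i + 2 * k + 2 + 1), Nat.factorial_succ (2 * i + 2 * k + 2),
    Nat.factorial_succ (i + k + 1), Nat.factorial_succ (i + 1), Nat.factorial_succ i,
    Nat.factorial_succ k]
  push_cast
  have h1 := Nat.cast_ne_zero (R := ℝ).mpr (Nat.factorial_ne_zero (i + k + 1))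
  have h2 := Nat.cast_ne_zero (R := ℝ).mpr (Nat.factorial_ne_zero i)
  have h3 := Nat.cast_ne_zero (R := ℝ).mpr (Nat.factorial_ne_zero k)
  have h4 : (i : ℝ) + k + 1 + 1 ≠ 0 := by positivity
  have h5 : (i : ℝ) + 1 ≠ 0 := by positivity
  have h6 : (i : ℝ) + 1 + 1 ≠ 0 := by positivity
  have h7 : (k : ℝ) + 1 ≠ 0 := by positivity
  field_simp
  ring

lemma coeff_krallLegendre (α : ℝ) (k i : ℕ) :
    (krallLegendre α (i + 2 * k)).coeff i =
      krallWeight k i *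
        (α + ((i : ℝ) + 2 * k) * ((i : ℝ) + 2 * k - 1) / 2 + 2 * (k : ℝ)) := by
  simp only [krallLegendre, finsetSum_coeff, coeff_C_mul_X_pow]
  rw [Finset.sum_eq_single k]
  · rw [if_pos (by omega), show 2 * (i + 2 * k) - 2 * k = 2 * i + 2 * k by omega,
      show i + 2 * k - k = i + k by omega, show i + 2 * k - 2 * k = i by omega, krallWeight]
    push_cast
    ring
  · intro b hb hbk
    rw [Finset.mem_range] at hb
    rw [if_neg (by omega)]
  · intro h
    exact absurd (Finset.mem_range.mpr (by omega)) h

lemma coeff_krallLegendre_eq_zero (α : ℝ) {ν i : ℕ} (h : ∀ k, ν ≠ i + 2 * k) :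
    (krallLegendre α ν).coeff i = 0 := by
  simp only [krallLegendre, finsetSum_coeff, coeff_C_mul_X_pow]
  refine Finset.sum_eq_zero fun k hk => if_neg fun hik => h k ?_
  rw [Finset.mem_range] at hk
  omega

lemma krallOperator_krallLegendre (α : ℝ) (ν : ℕ) :
    krallOperator α (krallLegendre α ν) = C (krallEigenvalue α ν) * krallLegendre α ν := by
  ext i
  rw [coeff_krallOperator, coeff_C_mul]
  by_cases h : ∃ k, ν = i + 2 * k
  · obtain ⟨k, rfl⟩ := h
    rcases k with _ | _ | k
    · rw [coeff_krallLegendre_eq_zero α (i := i + 2) (by intros; omega),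
        coeff_krallLegendre_eq_zero α (i := i + 4) (by intros; omega)]
      simp
    · have h2 := coeff_krallLegendre α 0 (i + 2)
      rw [show i + 2 + 2 * 0 = i + 2 * (0 + 1) by ring] at h2
      rw [coeff_krallLegendre_eq_zero α (i := i + 4) (by intros; omega), h2,
        coeff_krallLegendre α]
      have s := krallWeight_step 0 i
      simp only [krallEigenvalue]
      push_cast at s ⊢
      linear_combination (-(2 * ((i : ℝ) + 1) * (i + 2) + 8 + 4 * α) *
        (α + ((i : ℝ) + 2) * ((i : ℝ) + 1) / 2)) * s
    · have h2 := coeff_krallLegendre α (k + 1) (i + 2)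
      rw [show i + 2 + 2 * (k + 1) = i + 2 * (k + 1 + 1) by ring] at h2
      have h4 := coeff_krallLegendre α k (i + 4)
      rw [show i + 4 + 2 * k = i + 2 * (k + 1 + 1) by ring] at h4
      rw [h2, h4, coeff_krallLegendre α]
      have s := krallWeight_step (k + 1) i
      have s' := krallWeight_step k (i + 2)
      rw [show i + 2 + 2 = i + 4 by ring] at s'
      simp only [krallEigenvalue]
      push_cast at s s' ⊢
      set n : ℝ := (i : ℝ) + 2 * (k + 2) with hn
      linear_combination (-(2 * ((i : ℝ) + 1) * (i + 2) + 8 + 4 * α) *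
          (α + n * (n - 1) / 2 + 2 * (k + 1))
          - 2 * (k + 1) * (2 * i + 2 * k + 7) * (α + n * (n - 1) / 2 + 2 * k)) * s
        + ((i : ℝ) + 1) * (i + 2) * (α + n * (n - 1) / 2 + 2 * k) * s'
  · push Not at h
    rw [coeff_krallLegendre_eq_zero α h,
      coeff_krallLegendre_eq_zero α (i := i + 2) (fun k hk => h (k + 1) (by omega)),
      coeff_krallLegendre_eq_zero α (i := i + 4) (fun k hk => h (k + 2) (by omega))]
    simp

lemma natDegree_krallLegendre_le (α : ℝ) (ν : ℕ) : (krallLegendre α ν).natDegree ≤ ν :=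
  natDegree_le_iff_coeff_eq_zero.mpr fun _ hi =>
    coeff_krallLegendre_eq_zero α fun _ => by omega

lemma coeff_krallLegendre_self_pos {α : ℝ} (hα : 0 < α) (ν : ℕ) :
    0 < (krallLegendre α ν).coeff ν := by
  have h := coeff_krallLegendre α 0 ν
  rw [mul_zero, add_zero] at h
  rw [h]
  have hν : (0 : ℝ) ≤ (ν : ℝ) * (ν - 1) := by
    rcases ν with _ | ν
    · simp
    · push_cast
      rw [add_sub_cancel_right]
      positivity
  refine mul_pos (by unfold krallWeight; positivity) ?_
  push_cast
  simp only [mul_zero, add_zero]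
  linarith

lemma krallOperator_sum_C_mul {ι : Type*} (α : ℝ) (s : Finset ι) (r : ι → ℝ) (f : ι → ℝ[X]) :
    krallOperator α (∑ k ∈ s, C (r k) * f k) = ∑ k ∈ s, C (r k) * krallOperator α (f k) := by
  simp only [krallOperator, iterate_derivative_sum, iterate_derivative_C_mul, derivative_sum,
    derivative_C_mul, Finset.mul_sum, ← Finset.sum_add_distrib]
  exact Finset.sum_congr rfl fun _ _ => by ring

lemma dvl_C_mul (c : ℝ) (p : ℝ[X]) (j : ℕ) (t : ℝ) : dvl (C c * p) j t = c * dvl p j t := by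
  simp [dvl, iterate_derivative_C_mul]

lemma dvl_mul_X_sub_C_succ (g : ℝ[X]) (a : ℝ) (j : ℕ) (t : ℝ) :
    dvl (g * (X - C a)) (j + 1) t = (t - a) * dvl g (j + 1) t + (j + 1) * dvl g j t := by
  have h : g * (X - C a) = g * X - C a * g := by ring
  simp only [dvl, h, iterate_derivative_sub, iterate_derivative_C_mul, iterate_derivative_mul_X,
    Nat.add_sub_cancel, eval_sub, eval_add, eval_mul, eval_X, eval_C, nsmul_eq_mul, eval_natCast]
  push_cast
  ring

lemma eval_krallOperator (α : ℝ) (p : ℝ[X]) (t : ℝ) :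
    (krallOperator α p).eval t = (1 - t ^ 2) ^ 2 * dvl p 4 t + 8 * t * (t ^ 2 - 1) * dvl p 3 t
      + 4 * (3 + α) * (t ^ 2 - 1) * dvl p 2 t + 8 * α * t * dvl p 1 t := by
  simp [krallOperator, dvl]

lemma eval_derivative_krallOperator (α : ℝ) (p : ℝ[X]) (t : ℝ) :
    (derivative (krallOperator α p)).eval t =
      (1 - t ^ 2) ^ 2 * dvl p 5 t + 12 * t * (t ^ 2 - 1) * dvl p 4 t
      + (8 * (3 * t ^ 2 - 1) + 4 * (3 + α) * (t ^ 2 - 1)) * dvl p 3 t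
      + (8 * (3 + α) * t + 8 * α * t) * dvl p 2 t + 8 * α * dvl p 1 t := by
  simp [krallOperator, dvl, derivative_pow]
  ring

/-- A polynomial of degree at most `N` vanishing at `N` distinct nodes is, at each node, a multiple
of the Lagrange basis polynomial times the corresponding linear factor. -/
lemma eq_C_mul_basis_mul_X_sub_C {N : ℕ} {p : ℝ[X]} (hp : p.natDegree ≤ N) {x : Fin N → ℝ}
    (hx : Function.Injective x) (hzero : ∀ n, p.eval (x n) = 0) (k : Fin N) :
    p = C (dvl p 1 (x k)) * (Lagrange.basis Finset.univ x k * (X - C (x k))) := by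
  obtain ⟨g, hg⟩ := dvd_iff_isRoot.mpr (hzero k)
  have hval : dvl p 1 (x k) = g.eval (x k) := by
    simp [dvl, hg]
  rcases eq_or_ne g 0 with rfl | hg0
  · rw [hval, eval_zero, C_0, zero_mul, hg, mul_zero]
  have hdeg : g.degree < (Finset.univ : Finset (Fin N)).card := by
    rw [Finset.card_univ, Fintype.card_fin, degree_eq_natDegree hg0]
    rw [hg, natDegree_mul (X_sub_C_ne_zero _) hg0, natDegree_X_sub_C] at hp
    exact_mod_cast Nat.lt_of_succ_le (by omega)
  have hgb : g = C (g.eval (x k)) * Lagrange.basis Finset.univ x k := by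
    conv_lhs => rw [Lagrange.eq_interpolate hx.injOn hdeg, Lagrange.interpolate_apply]
    refine Finset.sum_eq_single k (fun j _ hj => ?_) fun h => absurd (Finset.mem_univ k) h
    have hroot := hzero j
    rw [hg, eval_mul, eval_sub, eval_X, eval_C] at hroot
    rw [(mul_eq_zero.mp hroot).resolve_left (sub_ne_zero.mpr (hx.ne hj)), C_0, zero_mul]
  rw [hval, ← mul_assoc, ← hgb, mul_comm, ← hg]

/-- The action of the operator on the quotient of `p` by a root other than `t`. -/
lemma eval_krallOperator_of_ne {α w a t : ℝ} {p l : ℝ[X]} (hp : p = C w * (l * (X - C a)))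
    (hw : w ≠ 0) (hta : t ≠ a) (hl : l.eval t = 0) (hker : (krallOperator α p).eval t = 0)
    (r : ℝ) :
    r * (krallOperator α l).eval t = -(((t - a)⁻¹) ^ 2 * (r / w) *
      (4 * (1 - t ^ 2) ^ 2 * dvl p 3 t
        - 12 * (t ^ 2 - 1) * ((t - a)⁻¹ * (t ^ 2 - 1) - 2 * t) * dvl p 2 t
        + 8 * (t ^ 2 - 1) * (3 * ((t - a)⁻¹) ^ 2 * (t ^ 2 - 1) - 6 * (t - a)⁻¹ * t + α + 3) *
            dvl p 1 t)) := by
  have h (j : ℕ) : dvl p (j + 1) t = w * ((t - a) * dvl l (j + 1) t + (j + 1) * dvl l j t) := by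
    conv_lhs => rw [hp, dvl_C_mul, dvl_mul_X_sub_C_succ]
  have h1 := h 0
  have h2 := h 1
  have h3 := h 2
  have h4 := h 3
  have h0 : dvl l 0 t = 0 := hl
  have hta' : t - a ≠ 0 := sub_ne_zero.mpr hta
  rw [eval_krallOperator] at hker ⊢
  norm_num at h1 h2 h3 h4
  rw [h0] at h1
  rw [h1, h2, h3, h4] at hker
  rw [h1, h2, h3]
  field_simp
  refine mul_left_cancel₀ hw ?_
  linear_combination r * (t - a) ^ 3 * hker

/-- The action of the operator on the quotient of an eigenfunction `p` by one of its roots,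
at that root. -/
lemma eval_krallOperator_self {α μ w t : ℝ} {p l : ℝ[X]} (hp : p = C w * (l * (X - C t)))
    (hw : dvl p 1 t = w) (hw0 : w ≠ 0) (ht : t ^ 2 - 1 ≠ 0) (hroot : p.eval t = 0)
    (heig : krallOperator α p = C μ * p) :
    (krallOperator α l).eval t =
      8 * α * (t ^ 2 - 1) / 15 * (dvl p 3 t / dvl p 1 t)
        + 12 * α * t / 5 * (dvl p 2 t / dvl p 1 t)
        + (8 * α * (t ^ 2 + 1) + μ * (t ^ 2 - 1)) / (5 * (t ^ 2 - 1)) := by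
  have h (j : ℕ) : dvl p (j + 1) t = w * ((j + 1) * dvl l j t) := by
    conv_lhs => rw [hp, dvl_C_mul, dvl_mul_X_sub_C_succ, sub_self, zero_mul, zero_add]
  have h2 := h 1
  have h3 := h 2
  have h4 := h 3
  have h5 := h 4
  have hd : (derivative (krallOperator α p)).eval t = μ * dvl p 1 t := by
    rw [heig]
    simp [dvl]
  have he : (krallOperator α p).eval t = 0 := by rw [heig, eval_mul, hroot, mul_zero]
  rw [eval_derivative_krallOperator] at hd
  rw [eval_krallOperator] at he ⊢
  norm_num at h2 h3 h4 h5
  rw [h2, h3, h4, hw] at he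
  rw [h2, h3, h4, h5, hw] at hd
  rw [h2, h3, hw]
  field_simp
  refine mul_left_cancel₀ hw0 ?_
  linear_combination 15 * (t ^ 2 - 1) * hd - 30 * t * he

theorem stmt7
    (α : ℝ) (hα : 0 < α)
    (N : ℕ) (hN : 1 ≤ N)
    (x : Fin N → ℝ) (hx : Function.Injective x)
    (hzero : ∀ n : Fin N, (krallLegendre α N).eval (x n) = 0)
    (hin : ∀ n : Fin N, -1 < x n ∧ x n < 1) :
    ∀ (n m : Fin N),
      ∑ k ∈ Finset.univ.erase n,
        ((x n - x k)⁻¹) ^ 2 *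
          ((krallLegendre α m).eval (x k) / dvl (krallLegendre α N) 1 (x k)) *
          (4 * (1 - (x n) ^ 2) ^ 2 * dvl (krallLegendre α N) 3 (x n)
            - 12 * ((x n) ^ 2 - 1) * ((x n - x k)⁻¹ * ((x n) ^ 2 - 1) - 2 * x n) *
                dvl (krallLegendre α N) 2 (x n)
            + 8 * ((x n) ^ 2 - 1) *
                (3 * ((x n - x k)⁻¹) ^ 2 * ((x n) ^ 2 - 1) - 6 * (x n - x k)⁻¹ * x n + α + 3) *
                dvl (krallLegendre α N) 1 (x n))
      =
      (- (m : ℝ) * ((m : ℝ) + 1) * ((m : ℝ) ^ 2 + (m : ℝ) + 4 * α - 2)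
        + (8 * α * ((x n) ^ 2 - 1) / 15) *
            (dvl (krallLegendre α N) 3 (x n) / dvl (krallLegendre α N) 1 (x n))
        + (12 * α * x n / 5) *
            (dvl (krallLegendre α N) 2 (x n) / dvl (krallLegendre α N) 1 (x n))
        + (8 * α * ((x n) ^ 2 + 1)
            + (N : ℝ) * ((N : ℝ) + 1) * ((N : ℝ) ^ 2 + (N : ℝ) + 4 * α - 2) * ((x n) ^ 2 - 1)) /
            (5 * ((x n) ^ 2 - 1))) *
      (krallLegendre α m).eval (x n) := by
  intro n m
  set p := krallLegendre α N with hpdef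
  set q := krallLegendre α m with hqdef
  have hpdeg : p.natDegree ≤ N := natDegree_krallLegendre_le α N
  have hfac := eq_C_mul_basis_mul_X_sub_C hpdeg hx hzero
  have hp0 : p ≠ 0 := fun h => by
    have := coeff_krallLegendre_self_pos hα N
    rw [← hpdef, h, coeff_zero] at this
    exact this.false
  have hw (k : Fin N) : dvl p 1 (x k) ≠ 0 := fun h => hp0 (by rw [hfac k, h, C_0, zero_mul])
  have heig : krallOperator α p = C (krallEigenvalue α N) * p := krallOperator_krallLegendre α N
  have hker : (krallOperator α p).eval (x n) = 0 := by
    rw [heig, eval_mul, hzero n, mul_zero]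
  have hqdeg : q.degree < (Finset.univ : Finset (Fin N)).card := by
    rw [Finset.card_univ, Fintype.card_fin]
    exact (degree_le_of_natDegree_le (natDegree_krallLegendre_le α m)).trans_lt
      (by exact_mod_cast m.isLt)
  have hxn : x n ^ 2 - 1 ≠ 0 := by
    have := hin n
    nlinarith
  have hsum : krallEigenvalue α m * q.eval (x n) =
      ∑ k, q.eval (x k) * (krallOperator α (Lagrange.basis Finset.univ x k)).eval (x n) := by
    have h := congrArg (eval (x n)) (krallOperator_krallLegendre α m)
    rw [← hqdef, eval_mul, eval_C] at h
    rw [← h]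
    conv_lhs => rw [Lagrange.eq_interpolate hx.injOn hqdeg, Lagrange.interpolate_apply,
      krallOperator_sum_C_mul, eval_finsetSum]
    simp
  rw [← Finset.add_sum_erase _ _ (Finset.mem_univ n),
    eval_krallOperator_self (hfac n) rfl (hw n) hxn (hzero n) heig] at hsum
  rw [Finset.sum_congr rfl fun k hk => eval_krallOperator_of_ne (hfac k) (hw k)
      (hx.ne (Finset.ne_of_mem_erase hk).symm)
      (Lagrange.eval_basis_of_ne (Finset.ne_of_mem_erase hk) (Finset.mem_univ n)) hker _,
    Finset.sum_neg_distrib] at hsum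
  simp only [krallEigenvalue] at hsum
  linear_combination hsum
end

section
/- Let N ≥ 1 and let x_1,…,x_N be pairwise distinct real numbers with R_N(x_n) = 0 and x_n > 0 for every n (i.e., the zeros of the Krall-Laguerre polynomial R_N). Then for all n = 1,…,N and m = 0,1,…,N−1: ∑_{k=1, k≠n}^N A_{nk}² · (R_m(x_k)/R_N'(x_k)) · {4x_n² R_N'''(x_n) − 6x_n[2A_{nk}x_n + x_n − 2] R_N''(x_n) + 2x_n[12A_{nk}²x_n + 6A_{nk}(x_n − 2) + x_n − 2(α+3)] R_N'(x_n)} = { −m(m+2α+1) − (x_n(x_n+4α)/15)·(R_N'''(x_n)/R_N'(x_n)) + ((x_n² + 2(2α−1)x_n − 6α)/10)·(R_N''(x_n)/R_N'(x_n)) + [(α+1)x_n² + (N(N+2α+1) − α)x_n − 2α]/(5x_n) } · R_m(x_n). -/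
open Polynomial Finset

/-- The Krall-Laguerre polynomial of degree `ν` with parameter `α`:
`R_ν(x) = ∑_{k=0}^{ν} ((−1)^k/(k+1)!) C(ν,k) [k(α+ν+1) + α] x^k`. -/
noncomputable def krallLaguerre (α : ℝ) (ν : ℕ) : Polynomial ℝ :=
  ∑ k ∈ Finset.range (ν + 1),
    Polynomial.C ((-1 : ℝ) ^ k / ((k + 1).factorial : ℝ) * (ν.choose k : ℝ) *
      ((k : ℝ) * (α + (ν : ℝ) + 1) + α)) *
    Polynomial.X ^ k

/-- The fourth order differential operator of which the Krall-Laguerre polynomials are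
eigenfunctions. -/
noncomputable def krallLaguerreOp (α : ℝ) : ℝ[X] →ₗ[ℝ] ℝ[X] :=
  LinearMap.mulLeft ℝ (X ^ 2) ∘ₗ derivative ^ 4
    - LinearMap.mulLeft ℝ (C 2 * X ^ 2 - C 4 * X) ∘ₗ derivative ^ 3
    + LinearMap.mulLeft ℝ (X ^ 2 - C (2 * (α + 3)) * X) ∘ₗ derivative ^ 2
    + LinearMap.mulLeft ℝ (C (2 * (α + 1)) * X - C (2 * α)) ∘ₗ derivative

theorem krallLaguerreOp_apply (α : ℝ) (p : ℝ[X]) :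
    krallLaguerreOp α p = X ^ 2 * derivative^[4] p
      - (C 2 * X ^ 2 - C 4 * X) * derivative^[3] p
      + (X ^ 2 - C (2 * (α + 3)) * X) * derivative^[2] p
      + (C (2 * (α + 1)) * X - C (2 * α)) * derivative^[1] p := by
  simp [krallLaguerreOp, Module.End.pow_apply]

theorem eval_krallLaguerreOp (α : ℝ) (p : ℝ[X]) (t : ℝ) :
    (krallLaguerreOp α p).eval t = t ^ 2 * dvl p 4 t - 2 * t * (t - 2) * dvl p 3 t
      + t * (t - 2 * (α + 3)) * dvl p 2 t + 2 * ((α + 1) * t - α) * dvl p 1 t := by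
  rw [krallLaguerreOp_apply]
  simp only [dvl, eval_add, eval_sub, eval_mul, eval_pow, eval_X, eval_C]
  ring

theorem eval_derivative_krallLaguerreOp (α : ℝ) (p : ℝ[X]) (t : ℝ) :
    (derivative (krallLaguerreOp α p)).eval t = t ^ 2 * dvl p 5 t
      + (2 * t - 2 * t * (t - 2)) * dvl p 4 t
      + (t * (t - 2 * (α + 3)) - (4 * t - 4)) * dvl p 3 t
      + (2 * t - 2 * (α + 3) + 2 * ((α + 1) * t - α)) * dvl p 2 t
      + 2 * (α + 1) * dvl p 1 t := by
  rw [krallLaguerreOp_apply]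
  simp only [derivative_add, derivative_sub, derivative_mul, derivative_C, derivative_X,
    derivative_X_pow, ← Function.iterate_succ_apply' (f := derivative)]
  simp only [dvl, eval_add, eval_sub, eval_mul, eval_pow, eval_X, eval_C, eval_zero, eval_one]
  push_cast
  ring

theorem coeff_krallLaguerreOp (α : ℝ) (p : ℝ[X]) (k : ℕ) :
    (krallLaguerreOp α p).coeff k =
      (k * (k - 1) + 2 * (α + 1) * k) * p.coeff k
      - 2 * (k + 1) * (k * (k - 1) + (α + 3) * k + α) * p.coeff (k + 1)
      + (k + 3) * (k + 2) * (k + 1) * k * p.coeff (k + 2) := by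
  rw [krallLaguerreOp_apply]
  simp only [Function.iterate_succ, Function.iterate_zero, Function.comp, id, add_mul, sub_mul,
    mul_assoc, coeff_add, coeff_sub, coeff_C_mul]
  rcases k with _ | _ | k
  · simp [coeff_derivative]
  · simp [coeff_X_pow_mul', coeff_derivative, coeff_X_mul]
    ring
  · simp only [coeff_X_pow_mul, coeff_X_mul, coeff_derivative]
    push_cast
    ring

theorem coeff_krallLaguerre (α : ℝ) (ν k : ℕ) :
    (krallLaguerre α ν).coeff k = (-1 : ℝ) ^ k / ((k + 1).factorial : ℝ) * (ν.choose k : ℝ) *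
      ((k : ℝ) * (α + (ν : ℝ) + 1) + α) := by
  simp only [krallLaguerre, finsetSum_coeff, coeff_C_mul_X_pow]
  rw [Finset.sum_ite_eq]
  split_ifs with h
  · rfl
  · rw [Nat.choose_eq_zero_of_lt (by simpa [Nat.lt_succ_iff] using h)]
    simp

theorem degree_krallLaguerre_lt (α : ℝ) (ν : ℕ) :
    (krallLaguerre α ν).degree < ((ν + 1 : ℕ) : WithBot ℕ) := by
  rw [degree_lt_iff_coeff_zero]
  intro k hk
  rw [coeff_krallLaguerre, Nat.choose_eq_zero_of_lt hk]
  simp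

theorem krallLaguerre_ne_zero {α : ℝ} (hα : α ≠ 0) (ν : ℕ) : krallLaguerre α ν ≠ 0 := by
  intro h
  have h0 := coeff_krallLaguerre α ν 0
  simp [h] at h0
  exact hα h0.symm

/-- The Krall-Laguerre polynomials are eigenfunctions of `krallLaguerreOp`. -/
theorem krallLaguerreOp_krallLaguerre (α : ℝ) (ν : ℕ) :
    krallLaguerreOp α (krallLaguerre α ν) =
      C ((ν : ℝ) * (2 * α + 1 + ν)) * krallLaguerre α ν := by
  have choose_succ (k : ℕ) :
      (ν.choose (k + 1) : ℝ) = ν.choose k * ((ν : ℝ) - k) / (k + 1) := by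
    rw [eq_div_iff (by positivity)]
    rcases le_or_gt k ν with h | h
    · rw [← Nat.cast_sub h]
      exact_mod_cast Nat.choose_succ_right_eq ν k
    · simp [Nat.choose_eq_zero_of_lt h, Nat.choose_eq_zero_of_lt (h.trans k.lt_succ_self)]
  ext k
  rw [coeff_krallLaguerreOp, coeff_C_mul]
  simp only [coeff_krallLaguerre]
  rw [choose_succ (k + 1), choose_succ k, Nat.factorial_succ (k + 1 + 1),
    Nat.factorial_succ (k + 1)]
  have hf : ((k + 1).factorial : ℝ) ≠ 0 := by positivity
  push_cast
  field_simp
  ring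

theorem dvl_X_sub_C_mul (Q : ℝ[X]) (a t : ℝ) (j : ℕ) :
    dvl ((X - C a) * Q) (j + 1) t = (t - a) * dvl Q (j + 1) t + (j + 1) * dvl Q j t := by
  have h : derivative^[j + 1] ((X - C a) * Q) =
      (X - C a) * derivative^[j + 1] Q + C ((j : ℝ) + 1) * derivative^[j] Q := by
    induction j with
    | zero => simp [add_comm]
    | succ j ih =>
      rw [Function.iterate_succ_apply', ih]
      simp only [derivative_add, derivative_mul, derivative_sub, derivative_X, derivative_C,
        ← Function.iterate_succ_apply' (f := derivative)]
      simp only [map_add, Nat.cast_succ, map_one]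
      ring
  simp [dvl, h]

/-- The quotient of a polynomial, having a root at `t`, by a linear factor with a different root,
under the operator `krallLaguerreOp`. -/
theorem eval_krallLaguerreOp_of_ne {α μ t a : ℝ} {Q : ℝ[X]} (hta : t - a ≠ 0)
    (hroot : ((X - C a) * Q).eval t = 0)
    (heig : krallLaguerreOp α ((X - C a) * Q) = C μ * ((X - C a) * Q)) :
    (krallLaguerreOp α Q).eval t = -(((t - a)⁻¹) ^ 2 *
      (4 * t ^ 2 * dvl ((X - C a) * Q) 3 t
        - 6 * t * (2 * (t - a)⁻¹ * t + t - 2) * dvl ((X - C a) * Q) 2 t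
        + 2 * t * (12 * ((t - a)⁻¹) ^ 2 * t + 6 * (t - a)⁻¹ * (t - 2) + t - 2 * (α + 3)) *
            dvl ((X - C a) * Q) 1 t)) := by
  have h := congrArg (eval t) heig
  rw [eval_mul (p := C μ), hroot, mul_zero, eval_krallLaguerreOp] at h
  have hQ : dvl Q 0 t = 0 := by
    simpa [dvl, hta] using hroot
  rw [eval_krallLaguerreOp]
  have h1 := dvl_X_sub_C_mul Q a t 0
  have h2 := dvl_X_sub_C_mul Q a t 1
  have h3 := dvl_X_sub_C_mul Q a t 2
  have h4 := dvl_X_sub_C_mul Q a t 3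
  norm_num [hQ] at h1 h2 h3 h4
  rw [h1, h2, h3, h4] at h
  rw [h1, h2, h3]
  generalize dvl Q 1 t = q1 at *
  generalize dvl Q 2 t = q2 at *
  generalize dvl Q 3 t = q3 at *
  generalize dvl Q 4 t = q4 at *
  generalize t - a = d at *
  field_simp
  linear_combination d ^ 2 * h

/-- The quotient of an eigenfunction of `krallLaguerreOp` by the linear factor of a simple root. -/
theorem eval_krallLaguerreOp_self {α μ t : ℝ} {Q : ℝ[X]} (ht : t ≠ 0) (hQ : Q.eval t ≠ 0)
    (heig : krallLaguerreOp α ((X - C t) * Q) = C μ * ((X - C t) * Q)) :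
    (krallLaguerreOp α Q).eval t = dvl ((X - C t) * Q) 1 t *
      (-(t * (t + 4 * α) / 15) * (dvl ((X - C t) * Q) 3 t / dvl ((X - C t) * Q) 1 t)
        + ((t ^ 2 + 2 * (2 * α - 1) * t - 6 * α) / 10) *
            (dvl ((X - C t) * Q) 2 t / dvl ((X - C t) * Q) 1 t)
        + ((α + 1) * t ^ 2 + (μ - α) * t - 2 * α) / (5 * t)) := by
  have h := congrArg (eval t) heig
  have h' := congrArg (fun p => eval t (derivative p)) heig
  rw [eval_krallLaguerreOp, eval_C_mul, eval_mul, eval_sub, eval_X, eval_C, sub_self, zero_mul,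
    mul_zero] at h
  simp only [eval_derivative_krallLaguerreOp, derivative_C_mul, eval_C_mul] at h'
  change _ = μ * dvl ((X - C t) * Q) 1 t at h'
  have h1 := dvl_X_sub_C_mul Q t t 0
  have h2 := dvl_X_sub_C_mul Q t t 1
  have h3 := dvl_X_sub_C_mul Q t t 2
  have h4 := dvl_X_sub_C_mul Q t t 3
  have h5 := dvl_X_sub_C_mul Q t t 4
  have hQ0 : dvl Q 0 t ≠ 0 := hQ
  norm_num at h1 h2 h3 h4 h5
  rw [eval_krallLaguerreOp]
  rw [h1, h2, h3, h4] at h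
  rw [h1, h2, h3, h4, h5] at h'
  rw [h1, h2, h3]
  generalize dvl Q 0 t = q0 at *
  generalize dvl Q 1 t = q1 at *
  generalize dvl Q 2 t = q2 at *
  generalize dvl Q 3 t = q3 at *
  generalize dvl Q 4 t = q4 at *
  field_simp
  linear_combination 150 * t * h' - 75 * (t + 2) * h

theorem degree_lt_of_X_sub_C_mul {Q : ℝ[X]} {a : ℝ} {N : ℕ}
    (h : ((X - C a) * Q).degree < ((N + 1 : ℕ) : WithBot ℕ)) : Q.degree < (N : WithBot ℕ) := by
  rw [degree_mul, degree_X_sub_C, add_comm, Nat.cast_add, Nat.cast_one] at h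
  exact lt_of_add_lt_add_right h

/-- Lagrange interpolation through the zeros of a polynomial. -/
theorem eq_sum_of_roots {N : ℕ} {x : Fin N → ℝ} (hx : Function.Injective x) {q p : ℝ[X]}
    {Q : Fin N → ℝ[X]} (hQ : ∀ k, q = (X - C (x k)) * Q k) (hQx : ∀ k, (Q k).eval (x k) ≠ 0)
    (hq : q.degree < ((N + 1 : ℕ) : WithBot ℕ)) (hp : p.degree < (N : WithBot ℕ)) :
    p = ∑ k, C (p.eval (x k) / dvl q 1 (x k)) * Q k := by
  have hQdeg (k : Fin N) : (Q k).degree < (N : WithBot ℕ) :=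
    degree_lt_of_X_sub_C_mul (by rwa [← hQ k])
  refine eq_of_degrees_lt_of_eval_index_eq (s := Finset.univ) (v := x) hx.injOn
    (by simpa using hp) ?_ fun n _ => ?_
  · rw [Finset.card_univ, Fintype.card_fin, ← mem_degreeLT]
    refine Submodule.sum_mem _ fun k _ => ?_
    rw [← smul_eq_C_mul]
    exact Submodule.smul_mem _ _ (mem_degreeLT.2 (hQdeg k))
  · have hd : dvl q 1 (x n) = (Q n).eval (x n) := by
      rw [hQ n, dvl_X_sub_C_mul]
      simp [dvl]
    rw [eval_finsetSum, Finset.sum_eq_single n]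
    · rw [eval_C_mul, hd, div_mul_cancel₀ _ (hQx n)]
    · intro k _ hkn
      have h : q.eval (x n) = 0 := by rw [hQ n]; simp
      rw [hQ k, eval_mul, mul_eq_zero] at h
      rw [eval_C_mul, h.resolve_left (by simpa [sub_eq_zero] using fun e => hkn (hx e).symm),
        mul_zero]
    · simp

theorem stmt8
    (α : ℝ) (hα : 0 < α)
    (N : ℕ) (hN : 1 ≤ N)
    (x : Fin N → ℝ) (hx : Function.Injective x)
    (hzero : ∀ n : Fin N, (krallLaguerre α N).eval (x n) = 0)
    (hpos : ∀ n : Fin N, 0 < x n) :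
    ∀ (n m : Fin N),
      ∑ k ∈ Finset.univ.erase n,
        ((x n - x k)⁻¹) ^ 2 *
          ((krallLaguerre α m).eval (x k) / dvl (krallLaguerre α N) 1 (x k)) *
          (4 * (x n) ^ 2 * dvl (krallLaguerre α N) 3 (x n)
            - 6 * x n * (2 * (x n - x k)⁻¹ * x n + x n - 2) *
                dvl (krallLaguerre α N) 2 (x n)
            + 2 * x n * (12 * ((x n - x k)⁻¹) ^ 2 * x n + 6 * (x n - x k)⁻¹ * (x n - 2)
                + x n - 2 * (α + 3)) *
                dvl (krallLaguerre α N) 1 (x n))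
      =
      (- (m : ℝ) * ((m : ℝ) + 2 * α + 1)
        - (x n * (x n + 4 * α) / 15) *
            (dvl (krallLaguerre α N) 3 (x n) / dvl (krallLaguerre α N) 1 (x n))
        + (((x n) ^ 2 + 2 * (2 * α - 1) * x n - 6 * α) / 10) *
            (dvl (krallLaguerre α N) 2 (x n) / dvl (krallLaguerre α N) 1 (x n))
        + ((α + 1) * (x n) ^ 2 + ((N : ℝ) * ((N : ℝ) + 2 * α + 1) - α) * x n - 2 * α) /
            (5 * x n)) *
      (krallLaguerre α m).eval (x n) := by
  intro n m
  set q := krallLaguerre α N with hq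
  have hq0 : q ≠ 0 := krallLaguerre_ne_zero hα.ne' N
  have hqdeg : q.degree < ((N + 1 : ℕ) : WithBot ℕ) := degree_krallLaguerre_lt α N
  have hqeig := krallLaguerreOp_krallLaguerre α N
  rw [← hq] at hqeig
  choose Q hQ using fun k => dvd_iff_isRoot.2 (hzero k)
  have hQx (k : Fin N) : (Q k).eval (x k) ≠ 0 := by
    intro h
    refine hq0 ?_
    have hQdeg : (Q k).degree < (N : WithBot ℕ) :=
      degree_lt_of_X_sub_C_mul (by rwa [← hQ k])
    have hQk : Q k = 0 := by
      refine eq_zero_of_degree_lt_of_eval_index_eq_zero Finset.univ hx.injOn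
        (by simpa using hQdeg) fun j _ => ?_
      rcases eq_or_ne j k with rfl | hjk
      · exact h
      · have hj := hzero j
        rw [hQ k, eval_mul, mul_eq_zero] at hj
        exact hj.resolve_left (by simpa [sub_eq_zero] using fun e => hjk (hx e))
    rw [hQ k, hQk, mul_zero]
  set p := krallLaguerre α m with hp
  have hpdeg : p.degree < (N : WithBot ℕ) :=
    (degree_krallLaguerre_lt α m).trans_le (by exact_mod_cast m.isLt)
  have hpeig : (krallLaguerreOp α p).eval (x n) = m * (2 * α + 1 + m) * p.eval (x n) := by
    rw [hp, krallLaguerreOp_krallLaguerre, eval_C_mul]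
  have hd : dvl q 1 (x n) ≠ 0 := by
    rw [hQ n, dvl_X_sub_C_mul]
    simpa [dvl] using hQx n
  have hself := eval_krallLaguerreOp_self (hpos n).ne' (hQx n) (by rw [← hQ n]; exact hqeig)
  rw [← hQ n] at hself
  have hsum := congrArg (fun r => (krallLaguerreOp α r).eval (x n))
    (eq_sum_of_roots hx hQ hQx hqdeg hpdeg)
  simp only [← smul_eq_C_mul, map_sum, map_smul, eval_finsetSum, eval_smul, smul_eq_mul] at hsum
  rw [hpeig, ← Finset.add_sum_erase _ _ (Finset.mem_univ n), hself, ← mul_assoc,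
    div_mul_cancel₀ _ hd] at hsum
  rw [← neg_inj, ← Finset.sum_neg_distrib]
  refine Eq.trans (Finset.sum_congr rfl fun k hk => ?_) (sub_eq_of_eq_add' hsum).symm |>.trans ?_
  · have hnk : x n - x k ≠ 0 := sub_ne_zero.2 fun e => Finset.ne_of_mem_erase hk (hx e).symm
    rw [eval_krallLaguerreOp_of_ne hnk (by rw [← hQ k]; exact hzero n)
      (by rw [← hQ k]; exact hqeig), ← hQ k]
    ring
  · ring
end

section
/- Let N ≥ 1 and let x_1,…,x_N be pairwise distinct real numbers with S_N(x_n) = 0 and 0 < x_n < 1 for every n (i.e., the zeros of the Krall-Jacobi polynomial S_N). Then for all n = 1,…,N and m = 0,1,…,N−1: ∑_{k=1, k≠n}^N A_{nk}² · (S_m(x_k)/S_N'(x_k)) · ( 4x_n²(x_n−1)² S_N'''(x_n) + 6x_n(x_n−1)[−2A_{nk}x_n(x_n−1) + (4+α)x_n − 2] S_N''(x_n) − 2x_n{−12A_{nk}²x_n(x_n−1)² + 6A_{nk}(x_n−1)[(4+α)x_n − 2] − (α²+9α+2M+14)x_n + 2(3α+M+6)} S_N'(x_n) ) = ( −μ_m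 + (x_n[(4M−α²+4)x_n − 4M]/15)·(S_N'''(x_n)/S_N'(x_n)) + ([2M(x_n−1)(2(α+3)x_n − 3) − (α²−4)x_n((α+3)x_n − 2)]/(10(x_n−1)))·(S_N''(x_n)/S_N'(x_n)) + [−α³ − (M+1)α² + 4α + 4M + 4 + μ_N]x_n/(5(x_n−1)) + ([M(α−4) − μ_N]x_n + 2M)/(5x_n(x_n−1)) ) · S_m(x_n). -/
open Polynomial Finset

/-- The Krall-Jacobi polynomial of degree `ν` with parameters `α`, `M`:
`S_ν(x) = ∑_{k=0}^{ν} (−1)^{ν−k} C(ν,k) (α+1)_{ν+k} [k(ν+α)(ν+1) + (k+1)M]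
  / ((k+1)! (α+1)_ν) · x^k`, where `(a)_n` is the Pochhammer symbol. -/
noncomputable def krallJacobi (α M : ℝ) (ν : ℕ) : Polynomial ℝ :=
  ∑ k ∈ Finset.range (ν + 1),
    Polynomial.C ((-1 : ℝ) ^ (ν - k) * (ν.choose k : ℝ) *
        ((ascPochhammer ℝ (ν + k)).eval (α + 1)) *
        ((k : ℝ) * ((ν : ℝ) + α) * ((ν : ℝ) + 1) + ((k : ℝ) + 1) * M) /
      (((k + 1).factorial : ℝ) * (ascPochhammer ℝ ν).eval (α + 1))) *
    Polynomial.X ^ k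

/-- The Krall-Jacobi eigenvalue `μ_ν = ν(ν+α+1)[2M + (ν+1)(ν+α)]`. -/
noncomputable def krallJacobiEigen (α M : ℝ) (ν : ℕ) : ℝ :=
  (ν : ℝ) * ((ν : ℝ) + α + 1) * (2 * M + ((ν : ℝ) + 1) * ((ν : ℝ) + α))

/-- The coefficient of `x ^ k` in the Krall-Jacobi polynomial of degree `ν`. -/
noncomputable def krallJacobiCoeff (α M : ℝ) (ν k : ℕ) : ℝ :=
  (-1 : ℝ) ^ (ν - k) * (ν.choose k : ℝ) * ((ascPochhammer ℝ (ν + k)).eval (α + 1)) *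
    ((k : ℝ) * ((ν : ℝ) + α) * ((ν : ℝ) + 1) + ((k : ℝ) + 1) * M) /
      (((k + 1).factorial : ℝ) * (ascPochhammer ℝ ν).eval (α + 1))

theorem krallJacobi_coeff (α M : ℝ) (ν k : ℕ) :
    (krallJacobi α M ν).coeff k = krallJacobiCoeff α M ν k := by
  simp only [krallJacobi, finsetSum_coeff, coeff_C_mul, coeff_X_pow, mul_ite, mul_one, mul_zero,
    Finset.sum_ite_eq, Finset.mem_range]
  split_ifs with h
  · rfl
  · simp [krallJacobiCoeff, Nat.choose_eq_zero_of_lt (show ν < k by omega)]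

theorem krallJacobi_degree_lt {ν N : ℕ} (α M : ℝ) (h : ν < N) :
    (krallJacobi α M ν).degree < N := by
  rw [degree_lt_iff_coeff_zero]
  intro k hk
  simp [krallJacobi_coeff, krallJacobiCoeff, Nat.choose_eq_zero_of_lt (show ν < k by omega)]

theorem krallJacobi_ne_zero {α M : ℝ} (hα : -1 < α) (hM : 0 < M) (ν : ℕ) :
    krallJacobi α M ν ≠ 0 := by
  intro h
  have h1 := krallJacobi_coeff α M ν ν
  have h2 : 0 < (ascPochhammer ℝ (ν + ν)).eval (α + 1) := ascPochhammer_pos _ _ (by linarith)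
  have h3 : 0 < (ascPochhammer ℝ ν).eval (α + 1) := ascPochhammer_pos _ _ (by linarith)
  have h4 : 0 ≤ (ν : ℝ) * (ν + α) := by
    rcases Nat.eq_zero_or_pos ν with rfl | hν
    · simp
    · have : (1 : ℝ) ≤ ν := by exact_mod_cast hν
      exact mul_nonneg (by linarith) (by linarith)
  have h5 : 0 < (ν : ℝ) * (ν + α) * (ν + 1) + (ν + 1) * M := by positivity
  have h6 : 0 < krallJacobiCoeff α M ν ν := by
    unfold krallJacobiCoeff
    simp only [Nat.sub_self, pow_zero, Nat.choose_self, Nat.cast_one, one_mul]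
    positivity
  rw [h, coeff_zero] at h1
  exact h6.ne h1

/-- The hypergeometric part of the coefficients: `krallJacobiCoeff` without its linear factor. -/
noncomputable def krallJacobiTerm (α : ℝ) (ν k : ℕ) : ℝ :=
  (-1 : ℝ) ^ (ν - k) * (ν.choose k : ℝ) * ((ascPochhammer ℝ (ν + k)).eval (α + 1)) /
      (((k + 1).factorial : ℝ) * (ascPochhammer ℝ ν).eval (α + 1))

theorem krallJacobiCoeff_eq (α M : ℝ) (ν k : ℕ) :
    krallJacobiCoeff α M ν k =
      krallJacobiTerm α ν k * (k * (ν + α) * (ν + 1) + (k + 1) * M) := by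
  unfold krallJacobiCoeff krallJacobiTerm
  ring

theorem krallJacobiTerm_succ (α : ℝ) (ν k : ℕ) :
    krallJacobiTerm α ν (k + 1) * ((k + 1) * (k + 2)) =
      -(krallJacobiTerm α ν k * ((ν - k) * (α + 1 + ν + k))) := by
  rcases lt_or_ge k ν with h | h
  · obtain ⟨d, rfl⟩ := Nat.exists_eq_add_of_lt h
    have h1 : ((k + d + 1).choose (k + 1) : ℝ) * (k + 1) = (k + d + 1).choose k * (d + 1) := by
      have := Nat.choose_succ_right_eq (k + d + 1) k
      rw [show k + d + 1 - k = d + 1 by omega] at this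
      exact_mod_cast this
    have h2 : ((k + 1 + 1).factorial : ℝ) = (k + 2) * (k + 1).factorial := by
      rw [Nat.factorial_succ (k + 1)]
      push_cast
      ring
    have h3 : ((k + 1).factorial : ℝ) ≠ 0 := by positivity
    have h4 : ((k : ℝ) + 2) ≠ 0 := by positivity
    unfold krallJacobiTerm
    rw [show k + d + 1 - k = d + 1 by omega, show k + d + 1 - (k + 1) = d by omega,
      show k + d + 1 + (k + 1) = k + d + 1 + k + 1 by omega, ascPochhammer_succ_eval, h2, pow_succ]
    push_cast
    set E := (ascPochhammer ℝ (k + d + 1 + k)).eval (α + 1)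
    set P := (ascPochhammer ℝ (k + d + 1)).eval (α + 1)
    by_cases hP : P = 0
    · simp [hP]
    · field_simp
      linear_combination (E * (α + 1 + (k + d + 1 + k))) * h1
  · rcases h.eq_or_lt with rfl | h
    · simp [krallJacobiTerm]
    · simp [krallJacobiTerm, Nat.choose_eq_zero_of_lt h,
        Nat.choose_eq_zero_of_lt (show ν < k + 1 by omega)]

theorem krallJacobiCoeff_recurrence (α M : ℝ) (ν k : ℕ) :
    krallJacobiEigen α M k * krallJacobiCoeff α M ν k
      - 2 * (k + 1) * (k * (k - 1) * (k - 2) + (α + 6) * (k * (k - 1)) + (3 * α + M + 6) * k + M)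
        * krallJacobiCoeff α M ν (k + 1)
      + (k + 3) * (k + 2) * (k + 1) * k * krallJacobiCoeff α M ν (k + 2) =
    krallJacobiEigen α M ν * krallJacobiCoeff α M ν k := by
  have h1 := krallJacobiTerm_succ α ν k
  have h2 := krallJacobiTerm_succ α ν (k + 1)
  have hk : ((k : ℝ) + 1) * (k + 2) ≠ 0 := by positivity
  have e1 : krallJacobiTerm α ν (k + 1) =
      -(krallJacobiTerm α ν k * ((ν - k) * (α + 1 + ν + k))) / ((k + 1) * (k + 2)) := by
    rw [← h1]; field_simp
  have hk' : ((k : ℝ) + 2) * (k + 3) ≠ 0 := by positivity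
  have e2 : krallJacobiTerm α ν (k + 2) =
      -(krallJacobiTerm α ν (k + 1) * ((ν - (k + 1)) * (α + 1 + ν + (k + 1)))) /
        ((k + 2) * (k + 3)) := by
    push_cast at h2
    rw [eq_div_iff hk']
    linear_combination h2
  simp only [krallJacobiCoeff_eq, e2, e1, krallJacobiEigen]
  push_cast
  field_simp
  ring

theorem krallJacobi_differential_equation (α M : ℝ) (ν : ℕ) :
    X ^ 2 * (X - 1) ^ 2 * derivative^[4] (krallJacobi α M ν)
      + 2 * X * (X - 1) * (C (α + 4) * X - 2) * derivative^[3] (krallJacobi α M ν)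
      + X * (C (α ^ 2 + 9 * α + 2 * M + 14) * X - C (2 * (3 * α + M + 6)))
        * derivative^[2] (krallJacobi α M ν)
      + (C (2 * (α + 2) * (α + M + 1)) * X - C (2 * M)) * derivative^[1] (krallJacobi α M ν)
      = C (krallJacobiEigen α M ν) * krallJacobi α M ν := by
  set p := krallJacobi α M ν
  have key : X ^ 2 * (X - 1) ^ 2 * derivative^[4] p
      + 2 * X * (X - 1) * (C (α + 4) * X - 2) * derivative^[3] p
      + X * (C (α ^ 2 + 9 * α + 2 * M + 14) * X - C (2 * (3 * α + M + 6))) * derivative^[2] p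
      + (C (2 * (α + 2) * (α + M + 1)) * X - C (2 * M)) * derivative^[1] p
      = X ^ 4 * derivative^[4] p + C (-2) * (X ^ 3 * derivative^[4] p)
        + X ^ 2 * derivative^[4] p
        + C (2 * (α + 4)) * (X ^ 3 * derivative^[3] p)
        + C (-2 * (α + 6)) * (X ^ 2 * derivative^[3] p)
        + C 4 * (X ^ 1 * derivative^[3] p)
        + C (α ^ 2 + 9 * α + 2 * M + 14) * (X ^ 2 * derivative^[2] p)
        + C (-(2 * (3 * α + M + 6))) * (X ^ 1 * derivative^[2] p)
        + C (2 * (α + 2) * (α + M + 1)) * (X ^ 1 * derivative^[1] p)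
        + C (-(2 * M)) * derivative^[1] p := by
    simp only [C_mul, C_add, C_neg, C_pow, map_ofNat, map_one]
    ring
  rw [key]
  ext k
  have hrec := krallJacobiCoeff_recurrence α M ν k
  simp only [← krallJacobi_coeff] at hrec
  change _ = (C (krallJacobiEigen α M ν) * p).coeff k
  simp only [coeff_add, coeff_C_mul, coeff_X_pow_mul', coeff_iterate_derivative, nsmul_eq_mul]
  change _ * p.coeff k - _ * p.coeff (k + 1) + _ * p.coeff (k + 2) = _ * p.coeff k at hrec
  rw [← hrec]
  unfold krallJacobiEigen
  rcases k with _ | _ | _ | _ | k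
  iterate 4 simp [Nat.descFactorial_succ, add_assoc, -Nat.reduceAdd] <;> norm_num <;> ring
  have h2 : k + 4 - 2 = k + 2 := rfl
  have h3 : k + 4 - 3 = k + 1 := rfl
  simp [Nat.descFactorial_succ, h2, h3]
  ring

theorem eval_iterate_derivative_X_sub_C_mul (q : ℝ[X]) (a t : ℝ) (j : ℕ) :
    (derivative^[j + 1] ((X - C a) * q)).eval t =
      (t - a) * (derivative^[j + 1] q).eval t + (j + 1) * (derivative^[j] q).eval t := by
  have h : derivative^[j + 1] ((X - C a) * q) =
      (X - C a) * derivative^[j + 1] q + C ((j : ℝ) + 1) * derivative^[j] q := by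
    induction j with
    | zero => simp [derivative_mul, add_comm]
    | succ j ih =>
      rw [Function.iterate_succ_apply', ih]
      simp only [derivative_add, derivative_mul, derivative_sub, derivative_X, derivative_C,
        ← Function.iterate_succ_apply' derivative]
      push_cast
      simp only [C_add, C_1, sub_zero, one_mul, zero_mul, zero_add]
      ring
  rw [h]
  simp

/-- The value at `t` of the Krall-Jacobi operator applied to `q`. -/
noncomputable def krallJacobiOp (α M t : ℝ) (q : ℝ[X]) : ℝ :=
  t ^ 2 * (t - 1) ^ 2 * dvl q 4 t + 2 * t * (t - 1) * ((α + 4) * t - 2) * dvl q 3 t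
    + t * ((α ^ 2 + 9 * α + 2 * M + 14) * t - 2 * (3 * α + M + 6)) * dvl q 2 t
    + (2 * (α + 2) * (α + M + 1) * t - 2 * M) * dvl q 1 t

theorem krallJacobiOp_sum {ι : Type*} (α M t : ℝ) (s : Finset ι) (c : ι → ℝ) (q : ι → ℝ[X]) :
    krallJacobiOp α M t (∑ k ∈ s, C (c k) * q k) = ∑ k ∈ s, c k * krallJacobiOp α M t (q k) := by
  simp only [krallJacobiOp, dvl, iterate_derivative_sum, iterate_derivative_C_mul, eval_finsetSum,
    eval_mul, eval_C, Finset.mul_sum, ← Finset.sum_add_distrib]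
  exact Finset.sum_congr rfl fun _ _ => by ring

theorem krallJacobiOp_krallJacobi (α M t : ℝ) (ν : ℕ) :
    krallJacobiOp α M t (krallJacobi α M ν) =
      krallJacobiEigen α M ν * (krallJacobi α M ν).eval t := by
  have h := congrArg (eval t) (krallJacobi_differential_equation α M ν)
  simp only [eval_add, eval_mul, eval_sub, eval_pow, eval_X, eval_C, eval_one, eval_ofNat] at h
  exact h

theorem krallJacobi_derivative_equation (α M t : ℝ) (ν : ℕ) :
    t ^ 2 * (t - 1) ^ 2 * dvl (krallJacobi α M ν) 5 t
      + (2 * t * (t - 1) * (2 * t - 1) + 2 * t * (t - 1) * ((α + 4) * t - 2))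
        * dvl (krallJacobi α M ν) 4 t
      + (2 * (2 * t - 1) * ((α + 4) * t - 2) + 2 * t * (t - 1) * (α + 4)
          + t * ((α ^ 2 + 9 * α + 2 * M + 14) * t - 2 * (3 * α + M + 6)))
        * dvl (krallJacobi α M ν) 3 t
      + (2 * (α ^ 2 + 9 * α + 2 * M + 14) * t - 2 * (3 * α + M + 6)
          + (2 * (α + 2) * (α + M + 1) * t - 2 * M)) * dvl (krallJacobi α M ν) 2 t
      + 2 * (α + 2) * (α + M + 1) * dvl (krallJacobi α M ν) 1 t =
    krallJacobiEigen α M ν * dvl (krallJacobi α M ν) 1 t := by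
  have h := congrArg (fun q => eval t (derivative q)) (krallJacobi_differential_equation α M ν)
  simp only [derivative_add, derivative_mul, derivative_sub, derivative_X, derivative_C,
    derivative_one, derivative_ofNat, derivative_pow,
    ← Function.iterate_succ_apply' derivative,
    eval_add, eval_mul, eval_sub, eval_pow, eval_X, eval_C, eval_one, eval_zero, eval_ofNat] at h
  simp only [dvl]
  norm_num at h ⊢
  linear_combination h

section Interpolation

variable {N : ℕ} {x : Fin N → ℝ} {p : ℝ[X]} {q : Fin N → ℝ[X]}

theorem eval_cofactor_of_ne (hx : Function.Injective x) (hzero : ∀ n, p.eval (x n) = 0)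
    (hq : ∀ k, p = (X - C (x k)) * q k) {k j : Fin N} (h : j ≠ k) : (q k).eval (x j) = 0 := by
  have h1 := hzero j
  rw [hq k] at h1
  simp only [eval_mul, eval_sub, eval_X, eval_C] at h1
  exact (mul_eq_zero.mp h1).resolve_left (sub_ne_zero.mpr (hx.ne h))

theorem dvl_one_eq_eval_cofactor (hq : ∀ k, p = (X - C (x k)) * q k) (k : Fin N) :
    dvl p 1 (x k) = (q k).eval (x k) := by
  have h := eval_iterate_derivative_X_sub_C_mul (q k) (x k) (x k) 0
  rw [← hq k] at h
  simpa [dvl] using h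

theorem degree_cofactor_lt (hp : p ≠ 0) (hdeg : p.degree < (N + 1 : ℕ))
    (hq : ∀ k, p = (X - C (x k)) * q k) (k : Fin N) : (q k).degree < N := by
  have hq0 : q k ≠ 0 := fun h => hp (by rw [hq k, h, mul_zero])
  have h1 : p.natDegree < N + 1 := (natDegree_lt_iff_degree_lt hp).mpr hdeg
  rw [hq k, natDegree_mul (X_sub_C_ne_zero _) hq0, natDegree_X_sub_C] at h1
  exact (natDegree_lt_iff_degree_lt hq0).mp (by omega)

theorem dvl_one_ne_zero (hx : Function.Injective x) (hzero : ∀ n, p.eval (x n) = 0)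
    (hp : p ≠ 0) (hdeg : p.degree < (N + 1 : ℕ))
    (hq : ∀ k, p = (X - C (x k)) * q k) (k : Fin N) : dvl p 1 (x k) ≠ 0 := by
  intro h
  rw [dvl_one_eq_eval_cofactor hq k] at h
  have h0 : q k = 0 := by
    refine Polynomial.eq_zero_of_degree_lt_of_eval_index_eq_zero (s := Finset.univ)
      hx.injOn ?_ ?_
    · simpa using degree_cofactor_lt hp hdeg hq k
    · intro j _
      rcases eq_or_ne j k with rfl | hj
      · exact h
      · exact eval_cofactor_of_ne hx hzero hq hj
  exact hp (by rw [hq k, h0, mul_zero])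

theorem eq_sum_cofactor (hx : Function.Injective x) (hzero : ∀ n, p.eval (x n) = 0)
    (hp : p ≠ 0) (hdeg : p.degree < (N + 1 : ℕ))
    (hq : ∀ k, p = (X - C (x k)) * q k) {f : ℝ[X]} (hf : f.degree < N) :
    f = ∑ k, C (f.eval (x k) / dvl p 1 (x k)) * q k := by
  refine Polynomial.eq_of_degrees_lt_of_eval_index_eq (s := Finset.univ) hx.injOn ?_ ?_ ?_
  · simpa using hf
  · refine (degree_sum_le _ _).trans_lt ((Finset.sup_lt_iff (by simp)).mpr fun k _ => ?_)
    rw [← smul_eq_C_mul]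
    refine (degree_smul_le _ _).trans_lt ?_
    simpa using degree_cofactor_lt hp hdeg hq k
  · intro j _
    rw [eval_finsetSum, Finset.sum_eq_single j]
    · rw [eval_mul, eval_C, ← dvl_one_eq_eval_cofactor hq j,
        div_mul_cancel₀ _ (dvl_one_ne_zero hx hzero hp hdeg hq j)]
    · intro k _ hk
      rw [eval_mul, eval_cofactor_of_ne hx hzero hq hk.symm, mul_zero]
    · simp

end Interpolation

theorem krallJacobiOp_cofactor_of_ne {α M t a μ : ℝ} {p q : ℝ[X]} (hq : p = (X - C a) * q)
    (hta : t ≠ a) (hpt : p.eval t = 0) (hop : krallJacobiOp α M t p = μ * p.eval t) :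
    krallJacobiOp α M t q =
      -(((t - a)⁻¹) ^ 2 *
        (4 * t ^ 2 * (t - 1) ^ 2 * dvl p 3 t
          + 6 * t * (t - 1) * (-2 * (t - a)⁻¹ * t * (t - 1) + (4 + α) * t - 2) * dvl p 2 t
          - 2 * t *
              (-12 * ((t - a)⁻¹) ^ 2 * t * (t - 1) ^ 2
                + 6 * (t - a)⁻¹ * (t - 1) * ((4 + α) * t - 2)
                - (α ^ 2 + 9 * α + 2 * M + 14) * t + 2 * (3 * α + M + 6)) * dvl p 1 t)) := by
  have hd : t - a ≠ 0 := sub_ne_zero.mpr hta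
  have h0 : q.eval t = 0 := by
    rw [hq] at hpt
    simpa [hd] using hpt
  have h := eval_iterate_derivative_X_sub_C_mul q a t
  rw [← hq] at h
  have h1 : dvl p 1 t = (t - a) * dvl q 1 t := by simpa [dvl, h0] using h 0
  have h2 : dvl p 2 t = (t - a) * dvl q 2 t + 2 * dvl q 1 t := by
    have := h 1
    norm_num at this
    simpa [dvl] using this
  have h3 : dvl p 3 t = (t - a) * dvl q 3 t + 3 * dvl q 2 t := by
    have := h 2
    norm_num at this
    simpa [dvl] using this
  have h4 : dvl p 4 t = (t - a) * dvl q 4 t + 4 * dvl q 3 t := by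
    have := h 3
    norm_num at this
    simpa [dvl] using this
  rw [hpt, mul_zero] at hop
  unfold krallJacobiOp at hop ⊢
  rw [h1, h2, h3, h4] at hop
  rw [h1, h2, h3]
  field_simp
  linear_combination (t - a) ^ 2 * hop

theorem krallJacobiOp_cofactor_self {α M t : ℝ} {ν : ℕ} {q : ℝ[X]}
    (hq : krallJacobi α M ν = (X - C t) * q) (ht0 : t ≠ 0) (ht1 : t - 1 ≠ 0)
    (hp1 : dvl (krallJacobi α M ν) 1 t ≠ 0) :
    krallJacobiOp α M t q / dvl (krallJacobi α M ν) 1 t =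
      (t * ((4 * M - α ^ 2 + 4) * t - 4 * M) / 15) *
          (dvl (krallJacobi α M ν) 3 t / dvl (krallJacobi α M ν) 1 t)
        + ((2 * M * (t - 1) * (2 * (α + 3) * t - 3)
              - (α ^ 2 - 4) * t * ((α + 3) * t - 2)) / (10 * (t - 1))) *
            (dvl (krallJacobi α M ν) 2 t / dvl (krallJacobi α M ν) 1 t)
        + (- α ^ 3 - (M + 1) * α ^ 2 + 4 * α + 4 * M + 4 + krallJacobiEigen α M ν) * t /
            (5 * (t - 1))
        + ((M * (α - 4) - krallJacobiEigen α M ν) * t + 2 * M) / (5 * t * (t - 1)) := by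
  have hpt : (krallJacobi α M ν).eval t = 0 := by simp [hq]
  have hop := krallJacobiOp_krallJacobi α M t ν
  rw [hpt, mul_zero] at hop
  have hder := krallJacobi_derivative_equation α M t ν
  have h := eval_iterate_derivative_X_sub_C_mul q t t
  rw [← hq] at h
  set p := krallJacobi α M ν
  have h2 : dvl p 2 t = 2 * dvl q 1 t := by
    have := h 1
    norm_num at this
    simpa [dvl] using this
  have h3 : dvl p 3 t = 3 * dvl q 2 t := by
    have := h 2
    norm_num at this
    simpa [dvl] using this
  have h4 : dvl p 4 t = 4 * dvl q 3 t := by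
    have := h 3
    norm_num at this
    simpa [dvl] using this
  have h5 : dvl p 5 t = 5 * dvl q 4 t := by
    have := h 4
    norm_num at this
    simpa [dvl] using this
  unfold krallJacobiOp at hop ⊢
  rw [h2, h3, h4] at hop
  rw [h2, h3, h4, h5] at hder
  rw [h2, h3]
  field_simp
  linear_combination (150 * t * (t - 1)) * hder + 75 * ((α - 4) * t + 2) * hop

theorem stmt9
    (α M : ℝ) (hα : -1 < α) (hM : 0 < M)
    (N : ℕ) (hN : 1 ≤ N)
    (x : Fin N → ℝ) (hx : Function.Injective x)
    (hzero : ∀ n : Fin N, (krallJacobi α M N).eval (x n) = 0)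
    (hin : ∀ n : Fin N, 0 < x n ∧ x n < 1) :
    ∀ (n m : Fin N),
      ∑ k ∈ Finset.univ.erase n,
        ((x n - x k)⁻¹) ^ 2 *
          ((krallJacobi α M m).eval (x k) / dvl (krallJacobi α M N) 1 (x k)) *
          (4 * (x n) ^ 2 * (x n - 1) ^ 2 * dvl (krallJacobi α M N) 3 (x n)
            + 6 * x n * (x n - 1) *
                (-2 * (x n - x k)⁻¹ * x n * (x n - 1) + (4 + α) * x n - 2) *
                dvl (krallJacobi α M N) 2 (x n)
            - 2 * x n *
                (-12 * ((x n - x k)⁻¹) ^ 2 * x n * (x n - 1) ^ 2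
                  + 6 * (x n - x k)⁻¹ * (x n - 1) * ((4 + α) * x n - 2)
                  - (α ^ 2 + 9 * α + 2 * M + 14) * x n + 2 * (3 * α + M + 6)) *
                dvl (krallJacobi α M N) 1 (x n))
      =
      (- krallJacobiEigen α M m
        + (x n * ((4 * M - α ^ 2 + 4) * x n - 4 * M) / 15) *
            (dvl (krallJacobi α M N) 3 (x n) / dvl (krallJacobi α M N) 1 (x n))
        + ((2 * M * (x n - 1) * (2 * (α + 3) * x n - 3)
              - (α ^ 2 - 4) * x n * ((α + 3) * x n - 2)) / (10 * (x n - 1))) *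
            (dvl (krallJacobi α M N) 2 (x n) / dvl (krallJacobi α M N) 1 (x n))
        + (- α ^ 3 - (M + 1) * α ^ 2 + 4 * α + 4 * M + 4 + krallJacobiEigen α M N) * x n /
            (5 * (x n - 1))
        + ((M * (α - 4) - krallJacobiEigen α M N) * x n + 2 * M) /
            (5 * x n * (x n - 1))) *
      (krallJacobi α M m).eval (x n) := by
  intro n m
  set p := krallJacobi α M N with hpdef
  have hp : p ≠ 0 := krallJacobi_ne_zero hα hM N
  have hdeg : p.degree < (N + 1 : ℕ) := krallJacobi_degree_lt α M N.lt_succ_self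
  have hdvd : ∀ k, ∃ r, p = (X - C (x k)) * r := fun k => dvd_iff_isRoot.mpr (hzero k)
  choose q hq using hdvd
  have hp1 := dvl_one_ne_zero hx hzero hp hdeg hq n
  have hsum := congrArg (krallJacobiOp α M (x n))
    (eq_sum_cofactor hx hzero hp hdeg hq (krallJacobi_degree_lt α M m.isLt))
  rw [krallJacobiOp_krallJacobi, krallJacobiOp_sum,
    ← Finset.add_sum_erase _ _ (Finset.mem_univ n)] at hsum
  have hself := krallJacobiOp_cofactor_self (hq n) (hin n).1.ne'
    (sub_ne_zero.mpr (hin n).2.ne) hp1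
  rw [← hpdef] at hself
  have hoff : ∀ k ∈ Finset.univ.erase n, _ = _ := fun k hk =>
    congrArg (fun y => -((krallJacobi α M m).eval (x k) / dvl p 1 (x k) * y))
      (krallJacobiOp_cofactor_of_ne (hq k) (hx.ne (Finset.ne_of_mem_erase hk).symm) (hzero n)
        (krallJacobiOp_krallJacobi α M (x n) N))
  have hL := Finset.sum_congr rfl hoff
  rw [Finset.sum_neg_distrib] at hL
  refine (Finset.sum_congr rfl fun k _ => ?_).trans (hL.symm.trans ?_)
  · ring
  · rw [show ∀ a b c d e : ℝ, (-a + b + c + d + e) = -a + (b + c + d + e) by intros; ring,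
      ← hself]
    linear_combination hsum
end

section
/- Suppose 𝒟 = σ(x) d²/dx² + τ(x) d/dx with σ, τ real polynomials of degree at most 2 and 1 respectively, and 𝒟p_ν = μ_ν p_ν (μ_ν ∈ ℝ) for every ν. Let x_1,…,x_N be the N pairwise distinct real zeros of p_N, let π_n := ∏_{k≠n}(x_n − x_k), and define the N×N matrix M by M_{nj} = (π_j/π_n)·(−(𝒟ℓ_j)(x_n) + μ_N δ_{nj}). Then for each m = 0,1,…,N−1 the vector v^(m) with components v^(m)_n = p_m(x_n)/π_n is an eigenvector of M with eigenvalue μ_N − μ_m: ∑_{j=1}^N M_{nj} v^(m)_j = (μ_N − μ_m) v^(m)_n for every n. -/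
open Polynomial MeasureTheory Finset

/-- `piProd x n = ∏_{k ≠ n} (x_n − x_k)`. -/
noncomputable def piProd {N : ℕ} (x : Fin N → ℝ) (n : Fin N) : ℝ :=
  ∏ k ∈ Finset.univ.erase n, (x n - x k)

theorem piProd_ne_zero {N : ℕ} {x : Fin N → ℝ} (hx : Function.Injective x) (n : Fin N) :
    piProd x n ≠ 0 :=
  Finset.prod_ne_zero_iff.2 fun _ hk =>
    sub_ne_zero.2 fun h => (Finset.mem_erase.1 hk).1 (hx h).symm

/-- Lagrange interpolation reproduces polynomials of degree less than the number of nodes. -/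
theorem sum_C_eval_mul_lag {N : ℕ} {x : Fin N → ℝ} (hx : Function.Injective x)
    {q : Polynomial ℝ} (hq : q.degree < N) :
    ∑ j, C (q.eval (x j)) * lag x j = q := by
  have h := Lagrange.eq_interpolate (s := Finset.univ) (v := x) (f := q) hx.injOn (by simpa using hq)
  rw [Lagrange.interpolate_apply] at h
  exact h.symm

/-- Derivatives of the Lagrange interpolation formula at a point. -/
theorem sum_eval_mul_dvl_lag {N : ℕ} {x : Fin N → ℝ} (hx : Function.Injective x)
    {q : Polynomial ℝ} (hq : q.degree < N) (k : ℕ) (t : ℝ) :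
    ∑ j, q.eval (x j) * dvl (lag x j) k t = dvl q k t := by
  conv_rhs => rw [← sum_C_eval_mul_lag hx hq]
  simp [dvl, iterate_derivative_sum, iterate_derivative_C_mul, eval_finsetSum]

theorem stmt10
    (ω : Measure ℝ)
    (hmom : ∀ n : ℕ, Integrable (fun t : ℝ => t ^ n) ω)
    (hsupp : {t : ℝ | ∀ U ∈ nhds t, 0 < ω U}.Infinite)
    (p : ℕ → Polynomial ℝ)
    (hdeg : ∀ ν : ℕ, (p ν).degree = ν)
    (horth : ∀ μ' ν : ℕ, μ' ≠ ν → ∫ t, (p μ').eval t * (p ν).eval t ∂ω = 0)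
    (hnorm : ∀ ν : ℕ, 0 < ∫ t, ((p ν).eval t) ^ 2 ∂ω)
    (σ τ : Polynomial ℝ)
    (hσ : σ.degree ≤ (2 : WithBot ℕ)) (hτ : τ.degree ≤ (1 : WithBot ℕ))
    (μ : ℕ → ℝ)
    (hD : ∀ ν : ℕ,
      σ * Polynomial.derivative^[2] (p ν) + τ * Polynomial.derivative (p ν) =
        Polynomial.C (μ ν) * p ν)
    (N : ℕ) (hN : 0 < N)
    (x : Fin N → ℝ) (hx : Function.Injective x)
    (hzero : ∀ j : Fin N, (p N).eval (x j) = 0)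
    (M : Matrix (Fin N) (Fin N) ℝ)
    (hM : ∀ n j : Fin N,
      M n j = (piProd x j / piProd x n) *
        (-(σ.eval (x n) * dvl (lag x j) 2 (x n) + τ.eval (x n) * dvl (lag x j) 1 (x n))
          + μ N * (if n = j then 1 else 0))) :
    ∀ (m : Fin N) (n : Fin N),
      ∑ j : Fin N, M n j * ((p m).eval (x j) / piProd x j) =
      (μ N - μ m) * ((p m).eval (x n) / piProd x n) := by
  intro m n
  have hq : (p m).degree < N := by
    rw [hdeg]
    exact_mod_cast m.isLt
  have h2 := sum_eval_mul_dvl_lag hx hq 2 (x n)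
  have h1 := sum_eval_mul_dvl_lag hx hq 1 (x n)
  have hE : σ.eval (x n) * dvl (p m) 2 (x n) + τ.eval (x n) * dvl (p m) 1 (x n) =
      μ m * (p m).eval (x n) := by
    simpa [dvl] using congrArg (Polynomial.eval (x n)) (hD m)
  have hterm : ∀ j, M n j * ((p m).eval (x j) / piProd x j) =
      (-(σ.eval (x n) * ((p m).eval (x j) * dvl (lag x j) 2 (x n)) +
          τ.eval (x n) * ((p m).eval (x j) * dvl (lag x j) 1 (x n))) +
        μ N * (if n = j then (p m).eval (x j) else 0)) / piProd x n := by
    intro j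
    have hj := piProd_ne_zero hx j
    have hn := piProd_ne_zero hx n
    rw [hM]
    split_ifs <;> field_simp <;> ring
  rw [Finset.sum_congr rfl fun j _ => hterm j, ← Finset.sum_div, Finset.sum_add_distrib,
    Finset.sum_neg_distrib, Finset.sum_add_distrib, ← Finset.mul_sum, ← Finset.mul_sum,
    ← Finset.mul_sum, h1, h2, hE, Finset.sum_ite_eq, if_pos (Finset.mem_univ n)]
  ring
end

section
/- Let x_1,…,x_N be N pairwise distinct real numbers and set π_n := ∏_{k=1, k≠n}^N (x_n − x_k). Then the second derivatives of the Lagrange basis polynomials at the nodes are given by: ℓ_n''(x_m) = (2π_m/(π_n (x_m − x_n))) · ∑_{k=1, k≠m,n}^N 1/(x_m − x_k) for m ≠ n, and ℓ_n''(x_n) = ∑_{k=1, k≠n}^N ∑_{p=1, p≠n,k}^N 1/((x_n − x_k)(x_n − x_p)). -/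
open Polynomial Finset

open Lagrange in
theorem lag_eq_C_mul_nodal {N : ℕ} (x : Fin N → ℝ) (n : Fin N) :
    lag x n = C (piProd x n)⁻¹ * nodal (Finset.univ.erase n) x := by
  rw [lag, piProd, nodal_eq, Finset.prod_mul_distrib, ← Finset.prod_inv_distrib, map_prod]

open Lagrange in
theorem eval_derivative_nodal_of_ne {ι F : Type*} [DecidableEq ι] [Field F] (s : Finset ι)
    (v : ι → F) {t : F} (ht : ∀ i ∈ s, t ≠ v i) :
    (derivative (nodal s v)).eval t = (nodal s v).eval t * ∑ i ∈ s, (t - v i)⁻¹ := by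
  rw [derivative_nodal, eval_finsetSum, Finset.mul_sum]
  refine Finset.sum_congr rfl fun i hi => ?_
  have h : t - v i ≠ 0 := sub_ne_zero.mpr (ht i hi)
  rw [nodal_eq_mul_nodal_erase hi, eval_mul, eval_sub, eval_X, eval_C]
  field_simp

open Lagrange in
theorem eval_derivative_derivative_nodal_of_ne {ι F : Type*} [DecidableEq ι] [Field F]
    (s : Finset ι) (v : ι → F) {t : F} (ht : ∀ i ∈ s, t ≠ v i) :
    (derivative (derivative (nodal s v))).eval t =
      (nodal s v).eval t * ∑ i ∈ s, ∑ j ∈ s.erase i, ((t - v i) * (t - v j))⁻¹ := by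
  rw [derivative_nodal, derivative_sum, eval_finsetSum, Finset.mul_sum]
  refine Finset.sum_congr rfl fun i hi => ?_
  have h : t - v i ≠ 0 := sub_ne_zero.mpr (ht i hi)
  rw [eval_derivative_nodal_of_ne _ _ fun j hj => ht j (Finset.mem_of_mem_erase hj),
    nodal_eq_mul_nodal_erase hi, eval_mul, eval_sub, eval_X, eval_C]
  simp only [mul_inv]
  rw [← Finset.mul_sum]
  field_simp

open Lagrange in
theorem eval_derivative_derivative_nodal_at_node {ι R : Type*} [DecidableEq ι] [CommRing R]
    {s : Finset ι} (v : ι → R) {i : ι} (hi : i ∈ s) :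
    (derivative (derivative (nodal s v))).eval (v i) =
      2 * (derivative (nodal (s.erase i) v)).eval (v i) := by
  rw [nodal_eq_mul_nodal_erase hi]
  simp [derivative_mul, two_mul]

theorem stmt12
    (N : ℕ) (x : Fin N → ℝ) (hx : Function.Injective x) :
    (∀ m n : Fin N, m ≠ n →
      (Polynomial.derivative (Polynomial.derivative (lag x n))).eval (x m) =
        (2 * piProd x m / (piProd x n * (x m - x n))) *
          ∑ k ∈ (Finset.univ.erase m).erase n, (x m - x k)⁻¹) ∧
    (∀ n : Fin N,
      (Polynomial.derivative (Polynomial.derivative (lag x n))).eval (x n) =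
        ∑ k ∈ Finset.univ.erase n, ∑ p ∈ (Finset.univ.erase n).erase k,
          ((x n - x k) * (x n - x p))⁻¹) := by
  have hne : ∀ {i j : Fin N}, j ≠ i → x i ≠ x j := fun h => hx.ne h.symm
  have hpi : ∀ n, piProd x n ≠ 0 := fun n =>
    Finset.prod_ne_zero_iff.mpr fun k hk =>
      sub_ne_zero.mpr (hne (Finset.ne_of_mem_erase hk))
  constructor
  · intro m n hmn
    have hnm : n ∈ Finset.univ.erase m := Finset.mem_erase.mpr ⟨hmn.symm, Finset.mem_univ n⟩
    have hsub : x m - x n ≠ 0 := sub_ne_zero.mpr (hx.ne hmn)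
    have hprod : piProd x m =
        (x m - x n) * (Lagrange.nodal ((Finset.univ.erase m).erase n) x).eval (x m) := by
      rw [Lagrange.eval_nodal, piProd, Finset.mul_prod_erase _ (fun k => x m - x k) hnm]
    rw [lag_eq_C_mul_nodal, derivative_C_mul, derivative_C_mul, eval_C_mul,
      eval_derivative_derivative_nodal_at_node x
        (Finset.mem_erase.mpr ⟨hmn, Finset.mem_univ m⟩),
      Finset.erase_right_comm, eval_derivative_nodal_of_ne _ _ fun k hk =>
        hne (Finset.ne_of_mem_erase (Finset.mem_of_mem_erase hk)), hprod]
    have := hpi n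
    field_simp
  · intro n
    rw [lag_eq_C_mul_nodal, derivative_C_mul, derivative_C_mul, eval_C_mul,
      eval_derivative_derivative_nodal_of_ne _ _ fun k hk => hne (Finset.ne_of_mem_erase hk),
      Lagrange.eval_nodal, ← piProd, inv_mul_cancel_left₀ (hpi n)]
end

section
/- Let x_1,…,x_N be N pairwise distinct real numbers. Then for every integer k ≥ 1 and every n = 1,…,N, the k-th derivative of the Lagrange basis polynomial ℓ_n at its own node satisfies ℓ_n^{(k)}(x_n) = ψ_N^{(k+1)}(x_n) / ((k+1) · ψ_N'(x_n)), where ψ_N^{(j)} denotes the j-th derivative of the node polynomial ψ_N. -/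
open Polynomial Finset

/-- The node polynomial `ψ_N(t) = ∏_j (t − x_j)`. -/
noncomputable def nodePoly {N : ℕ} (x : Fin N → ℝ) : Polynomial ℝ :=
  ∏ j, (Polynomial.X - Polynomial.C (x j))

theorem iterate_derivative_succ_X_sub_C_mul {R : Type*} [CommRing R] (a : R) (p : R[X]) (k : ℕ) :
    derivative^[k + 1] ((X - C a) * p) =
      (X - C a) * derivative^[k + 1] p + ((k : R[X]) + 1) * derivative^[k] p := by
  induction k with
  | zero => simp [derivative_mul]; ring
  | succ k ih =>
    rw [Function.iterate_succ_apply', ih, derivative_add, derivative_mul, derivative_mul,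
      ← Function.iterate_succ_apply' derivative k p,
      ← Function.iterate_succ_apply' derivative (k + 1) p]
    simp
    ring

theorem dvl_succ_X_sub_C_mul (a : ℝ) (p : ℝ[X]) (k : ℕ) :
    dvl ((X - C a) * p) (k + 1) a = ((k : ℝ) + 1) * dvl p k a := by
  simp only [dvl, iterate_derivative_succ_X_sub_C_mul]
  simp

theorem nodePoly_eq_X_sub_C_mul {N : ℕ} (x : Fin N → ℝ) (n : Fin N) :
    nodePoly x = (X - C (x n)) * ∏ k ∈ univ.erase n, (X - C (x k)) :=
  (mul_prod_erase univ (fun k => X - C (x k)) (mem_univ n)).symm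

theorem lag_eq_C_mul_prod {N : ℕ} (x : Fin N → ℝ) (n : Fin N) :
    lag x n = C (∏ k ∈ univ.erase n, (x n - x k))⁻¹ * ∏ k ∈ univ.erase n, (X - C (x k)) := by
  rw [lag, prod_mul_distrib, ← map_prod, prod_inv_distrib]

theorem stmt13
    (N : ℕ) (x : Fin N → ℝ) (hx : Function.Injective x) :
    ∀ (k : ℕ), 1 ≤ k → ∀ (n : Fin N),
      dvl (lag x n) k (x n) =
        dvl (nodePoly x) (k + 1) (x n) / (((k : ℝ) + 1) * dvl (nodePoly x) 1 (x n)) := by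
  intro k _ n
  have hne : ∏ j ∈ univ.erase n, (x n - x j) ≠ 0 :=
    prod_ne_zero_iff.mpr fun j hj => sub_ne_zero.mpr (hx.ne (ne_of_mem_erase hj).symm)
  have hk : (k : ℝ) + 1 ≠ 0 := by positivity
  have h_one : dvl (nodePoly x) 1 (x n) = ∏ j ∈ univ.erase n, (x n - x j) := by
    rw [nodePoly_eq_X_sub_C_mul x n, ← zero_add 1, dvl_succ_X_sub_C_mul]
    simp [dvl, eval_prod]
  rw [h_one, nodePoly_eq_X_sub_C_mul x n, dvl_succ_X_sub_C_mul, lag_eq_C_mul_prod,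
    mul_div_mul_left _ _ hk]
  simp only [dvl, iterate_derivative_C_mul, eval_mul, eval_C]
  rw [div_eq_inv_mul]
end

section
/- Let x_1,…,x_N be N pairwise distinct real numbers. Then for every integer k ≥ 1 and all m ≠ n (1 ≤ m, n ≤ N), the derivatives of the Lagrange basis polynomials satisfy the recursion ℓ_n^{(k)}(x_m) = (1/(x_m − x_n)) · ( ψ_N^{(k)}(x_m)/ψ_N'(x_n) − k · ℓ_n^{(k−1)}(x_m) ), where ℓ_n^{(0)} = ℓ_n and ψ_N^{(j)} denotes the j-th derivative of the node polynomial. -/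
open Polynomial Finset

theorem iterate_derivative_mul_X_sub_C {R : Type*} [CommRing R] (p : R[X]) (a : R) (k : ℕ) :
    derivative^[k] (p * (X - C a)) =
      derivative^[k] p * (X - C a) + k • derivative^[k - 1] p := by
  rw [mul_sub, iterate_derivative_sub, iterate_derivative_mul_X, mul_comm p (C a),
    iterate_derivative_C_mul]
  ring

theorem prod_sub_ne_zero {N : ℕ} {x : Fin N → ℝ} (hx : Function.Injective x) (n : Fin N) :
    ∏ k ∈ univ.erase n, (x n - x k) ≠ 0 :=
  prod_ne_zero_iff.2 fun _ hk => sub_ne_zero.2 (hx.ne (ne_of_mem_erase hk).symm)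

theorem nodePoly_eq_lag_mul {N : ℕ} {x : Fin N → ℝ} (hx : Function.Injective x) (n : Fin N) :
    nodePoly x = C (∏ k ∈ univ.erase n, (x n - x k)) * (lag x n * (X - C (x n))) := by
  have h := prod_sub_ne_zero hx n
  rw [nodePoly, lag, ← prod_erase_mul univ _ (mem_univ n), prod_mul_distrib, ← map_prod,
    prod_inv_distrib, mul_assoc, ← mul_assoc (C _), ← C_mul, mul_inv_cancel₀ h, C_1, one_mul]

theorem eval_lag_self {N : ℕ} {x : Fin N → ℝ} (hx : Function.Injective x) (n : Fin N) :
    (lag x n).eval (x n) = 1 := by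
  rw [lag, eval_prod]
  refine prod_eq_one fun k hk => ?_
  simpa using inv_mul_cancel₀ (sub_ne_zero.2 (hx.ne (ne_of_mem_erase hk).symm))

theorem dvl_nodePoly {N : ℕ} {x : Fin N → ℝ} (hx : Function.Injective x) (n : Fin N)
    (k : ℕ) (t : ℝ) :
    dvl (nodePoly x) k t = (∏ j ∈ univ.erase n, (x n - x j)) *
      (dvl (lag x n) k t * (t - x n) + k * dvl (lag x n) (k - 1) t) := by
  simp only [dvl]
  rw [nodePoly_eq_lag_mul hx n, iterate_derivative_C_mul, iterate_derivative_mul_X_sub_C,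
    eval_mul, eval_C]
  simp

theorem dvl_nodePoly_one_self {N : ℕ} {x : Fin N → ℝ} (hx : Function.Injective x) (n : Fin N) :
    dvl (nodePoly x) 1 (x n) = ∏ j ∈ univ.erase n, (x n - x j) := by
  rw [dvl_nodePoly hx n]
  simp [dvl, eval_lag_self hx n]

theorem stmt14
    (N : ℕ) (x : Fin N → ℝ) (hx : Function.Injective x) :
    ∀ (k : ℕ), 1 ≤ k → ∀ (m n : Fin N), m ≠ n →
      dvl (lag x n) k (x m) =
        (1 / (x m - x n)) *
          (dvl (nodePoly x) k (x m) / dvl (nodePoly x) 1 (x n)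
            - (k : ℝ) * dvl (lag x n) (k - 1) (x m)) := by
  intro k _ m n hmn
  have hne : x m - x n ≠ 0 := sub_ne_zero.2 (hx.ne hmn)
  rw [dvl_nodePoly_one_self hx n, dvl_nodePoly hx n k,
    mul_div_cancel_left₀ _ (prod_sub_ne_zero hx n)]
  field_simp
  ring
end

section
/- Let σ and τ be real polynomials with deg σ ≤ 2 and deg τ ≤ 1, and write τ' and σ'' for the constant values of the derivative of τ and the second derivative of σ. Let p be a real polynomial of degree N whose N zeros x_1,…,x_N are real and pairwise distinct, and suppose σ p'' + τ p' = μ_N p, where μ_N = N[τ' + (1/2)(N−1)σ'']. Form the Lagrange basis polynomials ℓ_j with respect to the nodes x_1,…,x_N and define D^c_{mn} := σ(x_m) ℓ_n''(x_m) + τ(x_m) ℓ_n'(x_m). Then: (i) for m ≠ n, D^c_{mn} = −(2σ(x_m)/(x_m − x_n)²) · (p'(x_m)/p'(x_n)); and (ii) for every n with σ(x_n) ≠ 0, D^c_{nn} = −(τ(x_n)/(6σ(x_n)))·(τ(x_n) − 2σ'(x_n)) + (1/3)(N−1)[τ' + (1/2)N σ'']. -/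
open Polynomial Finset

/-- A polynomial of degree `N` vanishing at `N` distinct nodes is a nonzero multiple of
the node polynomial, hence of `(t - x_n) ℓ_n(t)`. -/
theorem exists_eq_mul_lag {N : ℕ} {p : Polynomial ℝ} (hp : p.degree = (N : WithBot ℕ))
    {x : Fin N → ℝ} (hx : Function.Injective x) (hzero : ∀ n, p.eval (x n) = 0) (n : Fin N) :
    ∃ c : ℝ, c ≠ 0 ∧ p = C c * ((X - C (x n)) * lag x n) := by
  have hp0 : p ≠ 0 := by
    rintro rfl
    simp at hp
  obtain ⟨r, hr⟩ : (∏ k, (X - C (x k))) ∣ p :=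
    Finset.prod_dvd_of_coprime
      (fun i _ j _ hij => pairwise_coprime_X_sub_C hx hij)
      (fun k _ => dvd_iff_isRoot.mpr (hzero k))
  have hr0 : r ≠ 0 := right_ne_zero_of_mul (hr ▸ hp0)
  have hdeg : r.natDegree = 0 := by
    have h := natDegree_mul (monic_prod_X_sub_C x univ).ne_zero hr0
    rw [← hr, natDegree_eq_of_degree_eq_some hp, natDegree_finsetProd_X_sub_C_eq_card] at h
    simpa using h
  obtain ⟨d, rfl⟩ := natDegree_eq_zero.mp hdeg
  have hd : d ≠ 0 := by
    rintro rfl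
    simp at hr0
  have hnode : (∏ k ∈ univ.erase n, (x n - x k)) ≠ 0 :=
    Finset.prod_ne_zero_iff.mpr fun k hk =>
      sub_ne_zero.mpr fun h => (Finset.ne_of_mem_erase hk) (hx h).symm
  refine ⟨d * ∏ k ∈ univ.erase n, (x n - x k), mul_ne_zero hd hnode, ?_⟩
  have hC : C (∏ k ∈ univ.erase n, (x n - x k)) * C (∏ k ∈ univ.erase n, (x n - x k))⁻¹ =
      (1 : Polynomial ℝ) := by
    rw [← C_mul, mul_inv_cancel₀ hnode, C_1]
  rw [hr, ← Finset.mul_prod_erase univ _ (mem_univ n), lag, Finset.prod_mul_distrib,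
    ← map_prod, Finset.prod_inv_distrib, C_mul]
  linear_combination (-(X - C (x n)) * (∏ k ∈ univ.erase n, (X - C (x k))) * C d) * hC

theorem eval_lag_of_ne {N : ℕ} (x : Fin N → ℝ) {m n : Fin N} (h : m ≠ n) :
    (lag x n).eval (x m) = 0 := by
  rw [lag, eval_prod]
  exact Finset.prod_eq_zero (mem_erase.mpr ⟨h, mem_univ m⟩) (by simp)

theorem stmt16
    (σ τ : Polynomial ℝ)
    (hσ : σ.degree ≤ (2 : WithBot ℕ)) (hτ : τ.degree ≤ (1 : WithBot ℕ))
    (tp sp : ℝ)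
    (hτ' : Polynomial.derivative τ = Polynomial.C tp)
    (hσ'' : Polynomial.derivative (Polynomial.derivative σ) = Polynomial.C sp)
    (N : ℕ) (p : Polynomial ℝ) (hp : p.degree = (N : WithBot ℕ))
    (x : Fin N → ℝ) (hx : Function.Injective x)
    (hzero : ∀ n : Fin N, p.eval (x n) = 0)
    (hODE : σ * Polynomial.derivative (Polynomial.derivative p) +
        τ * Polynomial.derivative p =
      Polynomial.C ((N : ℝ) * (tp + (1 / 2) * ((N : ℝ) - 1) * sp)) * p) :
    (∀ m n : Fin N, m ≠ n →
      σ.eval (x m) * dvl (lag x n) 2 (x m) + τ.eval (x m) * dvl (lag x n) 1 (x m) =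
        -(2 * σ.eval (x m) / (x m - x n) ^ 2) * (dvl p 1 (x m) / dvl p 1 (x n))) ∧
    (∀ n : Fin N, σ.eval (x n) ≠ 0 →
      σ.eval (x n) * dvl (lag x n) 2 (x n) + τ.eval (x n) * dvl (lag x n) 1 (x n) =
        -(τ.eval (x n) / (6 * σ.eval (x n))) * (τ.eval (x n) - 2 * dvl σ 1 (x n))
          + (1 / 3) * ((N : ℝ) - 1) * (tp + (1 / 2) * (N : ℝ) * sp)) := by
  refine ⟨fun m n hmn => ?_, fun n hσn => ?_⟩
  · obtain ⟨c, hc, hpc⟩ := exists_eq_mul_lag hp hx hzero n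
    have hsub : x m - x n ≠ 0 := sub_ne_zero.mpr fun h => hmn (hx h)
    have hm := eval_lag_of_ne x hmn
    have hn := eval_lag_self hx n
    have hode := congrArg (eval (x m)) hODE
    simp only [eval_add, eval_mul, hzero, mul_zero] at hode
    simp only [dvl, Function.iterate_succ, Function.iterate_zero, Function.comp_apply, id]
    rw [hpc] at hode ⊢
    simp only [derivative_mul, derivative_add, derivative_sub, derivative_X, derivative_C,
      eval_add, eval_mul, eval_sub, eval_X, eval_C,
      hm, hn, zero_mul, zero_add, add_zero, one_mul, mul_one, sub_zero,
      sub_self] at hode ⊢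
    field_simp
    apply mul_left_cancel₀ hc
    linear_combination hode
  · obtain ⟨c, hc, hpc⟩ := exists_eq_mul_lag hp hx hzero n
    have hn := eval_lag_self hx n
    have hode := congrArg (eval (x n)) hODE
    have hode' := congrArg (fun q => eval (x n) (derivative q)) hODE
    simp only [eval_add, eval_mul, hzero, mul_zero] at hode
    simp only [dvl, Function.iterate_succ, Function.iterate_zero, Function.comp_apply, id]
    rw [hpc] at hode hode'
    simp only [derivative_mul, derivative_add, derivative_sub, derivative_X, derivative_C, hτ',
      eval_add, eval_mul, eval_sub, eval_X, eval_C,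
      hn, zero_mul, zero_add, add_zero, one_mul, mul_one, sub_zero,
      sub_self] at hode hode' ⊢
    set s := eval (x n) σ
    set t := eval (x n) τ
    set s' := eval (x n) (derivative σ)
    set u := eval (x n) (derivative (lag x n))
    set v := eval (x n) (derivative (derivative (lag x n)))
    have h1 : 2 * s * u + t = 0 := by
      apply mul_left_cancel₀ hc
      linear_combination hode
    have h2 : 3 * s * v + 2 * (s' + t) * u + tp =
        (N : ℝ) * (tp + (1 / 2) * ((N : ℝ) - 1) * sp) := by
      apply mul_left_cancel₀ hc
      linear_combination hode'
    field_simp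
    linear_combination 12 * s * h2 + 6 * (t - 2 * s') * h1
end

section
/- Let a_1, a_2, a_3, a_4 be real polynomials, μ ∈ ℝ, and let p be a real polynomial of degree N whose N zeros x_1,…,x_N are real and pairwise distinct, satisfying a_4 p'''' + a_3 p''' + a_2 p'' + a_1 p' = μ p. Form the Lagrange basis polynomials ℓ_n with respect to the nodes x_1,…,x_N. Then for every n = 1,…,N: 5a_4(x_n) ℓ_n''''(x_n) + 4[a_4'(x_n) + a_3(x_n)] ℓ_n'''(x_n) + 3[a_3'(x_n) + a_2(x_n)] ℓ_n''(x_n) + 2[a_2'(x_n) + a_1(x_n)] ℓ_n'(x_n) + a_1'(x_n) − μ = 0. -/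
open Polynomial Finset

theorem X_sub_C_mul_lag {N : ℕ} (x : Fin N → ℝ) (j : Fin N) :
    (X - C (x j)) * lag x j =
      C (∏ k ∈ univ.erase j, (x j - x k)⁻¹) * Lagrange.nodal univ x := by
  rw [lag, prod_mul_distrib, map_prod, Lagrange.nodal, ← mul_prod_erase univ _ (mem_univ j)]
  ring

/-- A polynomial of degree `N` vanishing at `N` distinct nodes is a nonzero multiple
of `(X - x_j) ℓ_j`. -/
theorem exists_eq_C_mul_X_sub_C_mul_lag {N : ℕ} {p : ℝ[X]} (hp : p.degree = (N : WithBot ℕ))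
    {x : Fin N → ℝ} (hx : Function.Injective x) (hzero : ∀ n, p.eval (x n) = 0) (j : Fin N) :
    ∃ c : ℝ, c ≠ 0 ∧ p = C c * ((X - C (x j)) * lag x j) := by
  have hp0 : p ≠ 0 := by
    rintro rfl
    simp at hp
  have hprod : ∏ k ∈ univ.erase j, (x j - x k) ≠ 0 :=
    prod_ne_zero_iff.2 fun k hk => sub_ne_zero.2 fun h => (mem_erase.1 hk).1 (hx h).symm
  have hlc : p.leadingCoeff ≠ 0 := leadingCoeff_ne_zero.2 hp0
  refine ⟨p.leadingCoeff * ∏ k ∈ univ.erase j, (x j - x k), mul_ne_zero hlc hprod, ?_⟩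
  have hnodal : p = C p.leadingCoeff * Lagrange.nodal univ x := by
    have hdeg : p.degree = (C p.leadingCoeff * Lagrange.nodal univ x).degree := by
      rw [degree_C_mul hlc, Lagrange.degree_nodal, hp, card_univ, Fintype.card_fin]
    refine eq_of_degree_le_of_eval_index_eq univ hx.injOn (by simp [hp]) hdeg ?_ fun i hi => ?_
    · simp [(Lagrange.nodal_monic (s := univ) (v := x)).leadingCoeff]
    · simp [hzero, Lagrange.eval_nodal_at_node hi]
  rw [X_sub_C_mul_lag, ← mul_assoc, ← C_mul, prod_inv_distrib, mul_assoc,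
    mul_inv_cancel₀ hprod, mul_one, ← hnodal]

theorem stmt18
    (a₁ a₂ a₃ a₄ : Polynomial ℝ) (μ : ℝ)
    (N : ℕ) (p : Polynomial ℝ) (hp : p.degree = (N : WithBot ℕ))
    (x : Fin N → ℝ) (hx : Function.Injective x)
    (hzero : ∀ n : Fin N, p.eval (x n) = 0)
    (hODE : a₄ * Polynomial.derivative^[4] p + a₃ * Polynomial.derivative^[3] p +
        a₂ * Polynomial.derivative^[2] p + a₁ * Polynomial.derivative p =
      Polynomial.C μ * p) :
    ∀ n : Fin N,
      5 * a₄.eval (x n) * dvl (lag x n) 4 (x n)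
        + 4 * (dvl a₄ 1 (x n) + a₃.eval (x n)) * dvl (lag x n) 3 (x n)
        + 3 * (dvl a₃ 1 (x n) + a₂.eval (x n)) * dvl (lag x n) 2 (x n)
        + 2 * (dvl a₂ 1 (x n) + a₁.eval (x n)) * dvl (lag x n) 1 (x n)
        + dvl a₁ 1 (x n) - μ = 0 := by
  intro n
  obtain ⟨c, hc, hpc⟩ := exists_eq_C_mul_X_sub_C_mul_lag hp hx hzero n
  have hlag : (lag x n).eval (x n) = 1 := by
    rw [lag, eval_prod]
    refine prod_eq_one fun k hk => ?_
    have hne : x n - x k ≠ 0 := sub_ne_zero.2 fun h => (mem_erase.1 hk).1 (hx h).symm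
    simp [inv_mul_cancel₀ hne]
  have key := congrArg (fun q => (derivative q).eval (x n)) hODE
  rw [hpc] at key
  refine mul_left_cancel₀ hc ?_
  simp [hlag] at key
  simp only [dvl, Function.iterate_succ, Function.iterate_zero, Function.comp, id]
  linear_combination key
end
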